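/- arXiv:2203.16238 — 4 statements merged into one kernel-verified Lean document; each statement's English description precedes it below -/
import Mathlib

section
/- An n-variate polynomial p ∈ ℝ[x]_{2t} belongs to the interior of the SOS cone Σ[x]_t if and only if there exists a real sequence φ = (φ_α)_{α∈ℕⁿ_{2t}} with positive definite moment matrix M_t(φ) (i.e., φ lies in the interior of the dual cone Σ*_t) such that p(x) = v_t(x)^T M_t(φ)^{-1} v_t(x) for all x ∈ ℝⁿ; equivalently, 1/p is the Christoffel function Λ^φ_t of the linear functional L_φ. -/
open MeasureTheory Matrix Filter Topology

noncomputable section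

/-- Multi-indices `α ∈ ℕⁿ` with `|α| ≤ t`, encoded with entries in `Fin (t+1)`. -/
def MIdx (n t : ℕ) : Type :=
  {α : Fin n → Fin (t + 1) // (∑ i, ((α i : ℕ))) ≤ t}

instance (n t : ℕ) : Fintype (MIdx n t) := by unfold MIdx; infer_instance

instance (n t : ℕ) : DecidableEq (MIdx n t) := by unfold MIdx; infer_instance

/-- The monomial `x^α`. -/
def mon {n t : ℕ} (x : Fin n → ℝ) (α : MIdx n t) : ℝ :=
  ∏ i, x i ^ ((α.1 i : ℕ))

/-- Evaluation at `x` of the polynomial of degree at most `t` with coefficient vector `c`. -/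
def evalC {n t : ℕ} (c : MIdx n t → ℝ) (x : Fin n → ℝ) : ℝ :=
  ∑ α, c α * mon x α

/-- The moment matrix `M_t(φ)` of a sequence `φ = (φ_α)`, with entries `φ_{α+β}`. -/
def momMat (n t : ℕ) (φ : (Fin n → ℕ) → ℝ) : Matrix (MIdx n t) (MIdx n t) ℝ :=
  fun α β => φ (fun i => (α.1 i : ℕ) + (β.1 i : ℕ))

/-- The cone `Σ[x]_t` of sum-of-squares polynomials of degree at most `2t`, viewed as a
set of coefficient vectors (coordinates of `ℝ[x]_{2t}` in the monomial basis). -/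
def SOSCone (n t : ℕ) : Set (MIdx n (2 * t) → ℝ) :=
  {c | ∃ (k : ℕ) (q : Fin k → MIdx n t → ℝ),
     ∀ x : Fin n → ℝ, evalC c x = ∑ j, (evalC (q j) x) ^ 2}

section PosDef

variable {ι : Type*} [Fintype ι]

lemma dotProduct_single_one_mulVec [DecidableEq ι] (i j : ι) (v w : ι → ℝ) :
    v ⬝ᵥ Matrix.single i j 1 *ᵥ w = v i * w j := by
  rw [single_mulVec, one_mul, ← Pi.single, dotProduct_single]

lemma eventually_forall_dotProduct_mulVec_pos {P : Matrix ι ι ℝ}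
    (hP : ∀ v : ι → ℝ, v ≠ 0 → 0 < v ⬝ᵥ P *ᵥ v) :
    ∀ᶠ Q in 𝓝 P, ∀ v : ι → ℝ, v ≠ 0 → 0 < v ⬝ᵥ Q *ᵥ v := by
  have hcont : Continuous fun z : Matrix ι ι ℝ × (ι → ℝ) => z.2 ⬝ᵥ z.1 *ᵥ z.2 :=
    continuous_snd.dotProduct (continuous_fst.matrix_mulVec continuous_snd)
  have hsphere : ∀ᶠ Q in 𝓝 P, ∀ v ∈ Metric.sphere (0 : ι → ℝ) 1, 0 < v ⬝ᵥ Q *ᵥ v := by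
    refine (isCompact_sphere _ _).eventually_forall_of_forall_eventually
      (P := fun Q v => 0 < v ⬝ᵥ Q *ᵥ v) fun v hv => ?_
    refine hcont.continuousAt.eventually_const_lt (hP v ?_)
    exact ne_zero_of_mem_unit_sphere (⟨v, hv⟩ : Metric.sphere (0 : ι → ℝ) 1)
  filter_upwards [hsphere] with Q hQ v hv
  have hv' : 0 < ‖v‖ := norm_pos_iff.mpr hv
  have h := hQ (‖v‖⁻¹ • v) (by simp [norm_smul, hv'.ne'])
  simp only [mulVec_smul, smul_dotProduct, dotProduct_smul, smul_eq_mul] at h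
  have h2 := inv_pos.mpr hv'
  exact (mul_pos_iff_of_pos_left h2).mp ((mul_pos_iff_of_pos_left h2).mp h)

open scoped MatrixOrder Matrix.Norms.L2Operator in
lemma exists_dotProduct_mulVec_eq_sum_sq [DecidableEq ι] {Q : Matrix ι ι ℝ}
    (hQ : ∀ v : ι → ℝ, 0 ≤ v ⬝ᵥ Q *ᵥ v) :
    ∃ B : Matrix ι ι ℝ, ∀ v : ι → ℝ, v ⬝ᵥ Q *ᵥ v = ∑ i, ((B *ᵥ v) i) ^ 2 := by
  have hT : ∀ v : ι → ℝ, v ⬝ᵥ Qᵀ *ᵥ v = v ⬝ᵥ Q *ᵥ v := fun v => by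
    rw [mulVec_transpose, dotProduct_comm, dotProduct_mulVec]
  have hS : ∀ v : ι → ℝ, v ⬝ᵥ ((2⁻¹ : ℝ) • (Q + Qᵀ)) *ᵥ v = v ⬝ᵥ Q *ᵥ v := fun v => by
    rw [smul_mulVec, add_mulVec, dotProduct_smul, dotProduct_add, hT, smul_eq_mul]
    ring
  have hpsd : ((2⁻¹ : ℝ) • (Q + Qᵀ)).PosSemidef := by
    refine .of_dotProduct_mulVec_nonneg ?_ fun v => ?_
    · ext i j
      simp
      ring
    · rw [star_trivial, hS]
      exact hQ v
  obtain ⟨B, hB⟩ := CStarAlgebra.nonneg_iff_eq_star_mul_self.mp hpsd.nonneg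
  refine ⟨B, fun v => ?_⟩
  rw [← hS, hB, star_eq_conjTranspose, ← mulVec_mulVec, dotProduct_mulVec, vecMul_conjTranspose]
  simp [dotProduct, sq]

lemma Matrix.PosSemidef.dotProduct_mulVec_add_le {Q : Matrix ι ι ℝ} (hQ : Q.PosSemidef)
    (u v : ι → ℝ) :
    (u + v) ⬝ᵥ Q *ᵥ (u + v) ≤ 2 * (u ⬝ᵥ Q *ᵥ u) + 2 * (v ⬝ᵥ Q *ᵥ v) := by
  have h := hQ.dotProduct_mulVec_nonneg (u - v)
  simp only [star_trivial, mulVec_sub, mulVec_add, dotProduct_sub, dotProduct_add,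
    sub_dotProduct, add_dotProduct] at h ⊢
  linarith

lemma Matrix.PosSemidef.abs_apply_le [DecidableEq ι] {Q : Matrix ι ι ℝ} (hQ : Q.PosSemidef)
    (i j : ι) : |Q i j| ≤ (Q i i + Q j j) / 2 := by
  have hsym : Q j i = Q i j := by simpa using hQ.isHermitian.apply i j
  have h1 := hQ.dotProduct_mulVec_nonneg (Pi.single i 1 - Pi.single j 1)
  have h2 := hQ.dotProduct_mulVec_nonneg (Pi.single i 1 + Pi.single j 1)
  simp only [star_trivial, mulVec_sub, mulVec_add, dotProduct_sub, dotProduct_add,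
    sub_dotProduct, add_dotProduct, mulVec_single_one, single_one_dotProduct, col_apply] at h1 h2
  rw [abs_le]
  constructor <;> linarith

lemma isClosed_setOf_posSemidef : IsClosed {Q : Matrix ι ι ℝ | Q.PosSemidef} := by
  simp only [posSemidef_iff_dotProduct_mulVec, IsHermitian, Set.ofPred_and, Set.ofPred_forall]
  refine (isClosed_eq continuous_id.matrix_conjTranspose continuous_id).inter
    (isClosed_iInter fun v => isClosed_le continuous_const ?_)
  exact continuous_const.dotProduct (continuous_id.matrix_mulVec continuous_const)

lemma isCompact_setOf_posSemidef_forall_eq [DecidableEq ι] {X : Type*} {m : X → ι → ℝ}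
    (hm : Submodule.span ℝ (Set.range m) = ⊤) (p : X → ℝ) :
    IsCompact {Q : Matrix ι ι ℝ | Q.PosSemidef ∧ ∀ x, p x = m x ⬝ᵥ Q *ᵥ m x} := by
  set S := {Q : Matrix ι ι ℝ | Q.PosSemidef ∧ ∀ x, p x = m x ⬝ᵥ Q *ᵥ m x} with hS
  have hclosed : IsClosed S := by
    rw [hS, Set.ofPred_and, Set.ofPred_forall]
    refine isClosed_setOf_posSemidef.inter
      (isClosed_iInter fun x => isClosed_eq continuous_const ?_)
    exact continuous_const.dotProduct (continuous_id.matrix_mulVec continuous_const)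
  have hbound : ∀ u : ι → ℝ, ∃ C : ℝ, ∀ Q ∈ S, u ⬝ᵥ Q *ᵥ u ≤ C := fun u => by
    have hu : u ∈ Submodule.span ℝ (Set.range m) := hm ▸ Submodule.mem_top
    induction hu using Submodule.span_induction with
    | mem u hu =>
      obtain ⟨x, rfl⟩ := hu
      exact ⟨p x, fun Q hQ => (hQ.2 x).ge⟩
    | zero => exact ⟨0, fun Q _ => by simp⟩
    | add u v _ _ hu hv =>
      obtain ⟨C, hC⟩ := hu
      obtain ⟨D, hD⟩ := hv
      refine ⟨2 * C + 2 * D, fun Q hQ => (hQ.1.dotProduct_mulVec_add_le u v).trans ?_⟩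
      have := hC Q hQ
      have := hD Q hQ
      linarith
    | smul a u _ hu =>
      obtain ⟨C, hC⟩ := hu
      refine ⟨a ^ 2 * C, fun Q hQ => ?_⟩
      have := mul_le_mul_of_nonneg_left (hC Q hQ) (sq_nonneg a)
      simp only [mulVec_smul, smul_dotProduct, dotProduct_smul, smul_eq_mul]
      linarith
  choose C hC using fun i => hbound (Pi.single i 1)
  have hbox : IsCompact (Set.univ.pi fun i : ι => Set.univ.pi fun j : ι =>
      Set.Icc (-((C i + C j) / 2)) ((C i + C j) / 2)) :=
    isCompact_univ_pi fun i => isCompact_univ_pi fun j => isCompact_Icc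
  refine IsCompact.of_isClosed_subset hbox hclosed fun Q hQ i _ j _ => abs_le.mp ?_
  have h1 := hC i Q hQ
  have h2 := hC j Q hQ
  simp only [mulVec_single_one, single_one_dotProduct, col_apply] at h1 h2
  have := hQ.1.abs_apply_le i j
  linarith

lemma Matrix.PosDef.trace_inv_mul_eq_zero_of_det_le [DecidableEq ι] {Q E : Matrix ι ι ℝ}
    (hQ : Q.PosDef) (hmax : ∀ᶠ r : ℝ in 𝓝 0, (Q + r • E).det ≤ Q.det) :
    (Q⁻¹ * E).trace = 0 := by
  have hdet : 0 < Q.det := hQ.det_pos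
  set g := (det (1 + (Polynomial.X : Polynomial ℝ) • (Q⁻¹ * E).map Polynomial.C)) with hg
  have hev : ∀ r : ℝ, g.eval r = det (1 + r • (Q⁻¹ * E)) := fun r => by
    rw [hg, ← Polynomial.coe_evalRingHom, RingHom.map_det]
    congr 1
    generalize Q⁻¹ * E = F
    ext i j
    by_cases hij : i = j <;> simp [hij, mul_comm r]
  have hfac : ∀ r : ℝ, (Q + r • E).det = Q.det * g.eval r := fun r => by
    rw [hev, ← det_mul, mul_add, mul_one, mul_smul_comm, ← mul_assoc,
      mul_nonsing_inv _ hdet.ne'.isUnit, one_mul]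
  have hloc : IsLocalMax (fun r : ℝ => g.eval r) 0 := by
    filter_upwards [hmax] with r hr
    have h0 := hfac 0
    rw [zero_smul, add_zero] at h0
    rw [hfac r] at hr
    exact le_of_mul_le_mul_left (hr.trans_eq h0) hdet
  have := hloc.hasDerivAt_eq_zero (g.hasDerivAt 0)
  rwa [hg, derivative_det_one_add_X_smul] at this

end PosDef

section Monomials

variable {n t : ℕ}

/-- The multi-index with prescribed natural number entries. -/
def MIdx.ofNat (g : Fin n → ℕ) (hg : ∑ i, g i ≤ t) : MIdx n t :=
  ⟨fun i => ⟨g i, Nat.lt_succ_of_le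
    ((Finset.single_le_sum (fun j _ => Nat.zero_le (g j)) (Finset.mem_univ i)).trans hg)⟩, hg⟩

lemma MIdx.ext_nat {α β : MIdx n t} (h : ∀ i, (α.1 i : ℕ) = β.1 i) : α = β :=
  Subtype.ext (funext fun i => Fin.ext (h i))

/-- The sum of two multi-indices. -/
def MIdx.add (α β : MIdx n t) : MIdx n (2 * t) :=
  MIdx.ofNat (fun i => (α.1 i : ℕ) + β.1 i) (by
    rw [Finset.sum_add_distrib, two_mul]
    exact Nat.add_le_add α.2 β.2)

lemma mon_add (x : Fin n → ℝ) (α β : MIdx n t) : mon x (α.add β) = mon x α * mon x β := by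
  simp only [mon, ← Finset.prod_mul_distrib, ← pow_add]
  rfl

lemma exists_le_sum_eq (g : Fin n → ℕ) {s : ℕ} (hs : s ≤ ∑ i, g i) :
    ∃ a : Fin n → ℕ, (∀ i, a i ≤ g i) ∧ ∑ i, a i = s := by
  induction s with
  | zero => exact ⟨0, fun i => Nat.zero_le _, by simp⟩
  | succ s ih =>
    obtain ⟨a, ha, hsum⟩ := ih (by omega)
    obtain ⟨i, -, hi⟩ : ∃ i ∈ Finset.univ, a i < g i :=
      Finset.exists_lt_of_sum_lt (by omega)
    refine ⟨a + Pi.single i 1, fun j => ?_, ?_⟩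
    · by_cases hj : j = i
      · subst hj
        simpa using hi
      · simpa [hj] using ha j
    · simp [Finset.sum_add_distrib, hsum]

lemma MIdx.exists_add_eq (γ : MIdx n (2 * t)) : ∃ α β : MIdx n t, α.add β = γ := by
  obtain ⟨a, ha, hsum⟩ := exists_le_sum_eq (fun i => (γ.1 i : ℕ))
    (min_le_right t (∑ i, (γ.1 i : ℕ)))
  have hsub : ∑ i, ((γ.1 i : ℕ) - a i) + ∑ i, a i = ∑ i, (γ.1 i : ℕ) := by
    rw [← Finset.sum_add_distrib]
    exact Finset.sum_congr rfl fun i _ => Nat.sub_add_cancel (ha i)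
  have hγ := γ.2
  refine ⟨.ofNat a (by omega), .ofNat (fun i => (γ.1 i : ℕ) - a i) (by omega), ?_⟩
  exact MIdx.ext_nat fun i => Nat.add_sub_cancel' (ha i)

lemma evalC_eq_dotProduct (c : MIdx n t → ℝ) (x : Fin n → ℝ) : evalC c x = c ⬝ᵥ mon x := rfl

lemma eq_zero_of_forall_evalC_eq_zero {c : MIdx n t → ℝ} (h : ∀ x, evalC c x = 0) : c = 0 := by
  let e : MIdx n t → Fin n →₀ ℕ := fun α => Finsupp.equivFunOnFinite.symm fun i => (α.1 i : ℕ)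
  have he : Function.Injective e := fun α β hαβ =>
    MIdx.ext_nat fun i => DFunLike.congr_fun hαβ i
  have hp : (∑ α, MvPolynomial.monomial (e α) (c α) : MvPolynomial (Fin n) ℝ) = 0 := by
    refine MvPolynomial.funext fun x => ?_
    rw [map_sum, map_zero, ← h x]
    refine Finset.sum_congr rfl fun α _ => ?_
    rw [MvPolynomial.eval_monomial, Finsupp.prod_fintype _ _ fun i => pow_zero _]
    rfl
  funext β
  have := congrArg (MvPolynomial.coeff (e β)) hp
  simpa [MvPolynomial.coeff_sum, MvPolynomial.coeff_monomial, he.eq_iff] using this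

lemma span_range_mon : Submodule.span ℝ (Set.range (mon : (Fin n → ℝ) → MIdx n t → ℝ)) = ⊤ := by
  by_contra hne
  obtain ⟨f, hf, hle⟩ := Submodule.exists_le_ker_of_lt_top _ (lt_top_iff_ne_top.mpr hne)
  have hrep : ∀ v, f v = (fun α => f (Pi.single α 1)) ⬝ᵥ v := fun v => by
    conv_lhs => rw [pi_eq_sum_univ' v, map_sum]
    exact Finset.sum_congr rfl fun α _ => by
      rw [map_smul, smul_eq_mul, mul_comm]
  have hz := eq_zero_of_forall_evalC_eq_zero (c := fun α => f (Pi.single α 1)) fun x => by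
    rw [evalC_eq_dotProduct, ← hrep]
    exact hle (Submodule.subset_span ⟨x, rfl⟩)
  exact hf (LinearMap.ext fun v => by rw [hrep, hz]; simp)

lemma evalC_sub (c d : MIdx n t → ℝ) (x : Fin n → ℝ) :
    evalC (c - d) x = evalC c x - evalC d x := by
  simp only [evalC_eq_dotProduct, sub_dotProduct]

lemma evalC_smul (a : ℝ) (c : MIdx n t → ℝ) (x : Fin n → ℝ) :
    evalC (a • c) x = a * evalC c x := by
  simp only [evalC_eq_dotProduct, smul_dotProduct, smul_eq_mul]

lemma exists_evalC_eq_mon_dotProduct_self (n t : ℕ) : ∃ d : MIdx n (2 * t) → ℝ,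
    ∀ x, evalC d x = (mon x : MIdx n t → ℝ) ⬝ᵥ mon x := by
  refine ⟨∑ α : MIdx n t, Pi.single (α.add α) 1, fun x => ?_⟩
  simp only [evalC_eq_dotProduct, sum_dotProduct, single_one_dotProduct, mon_add]
  rfl

lemma exists_continuous_evalC_eq (n t : ℕ) :
    ∃ S : (MIdx n (2 * t) → ℝ) → Matrix (MIdx n t) (MIdx n t) ℝ, Continuous S ∧ S 0 = 0 ∧
      ∀ c x, evalC c x = mon x ⬝ᵥ S c *ᵥ mon x := by
  choose a b hab using MIdx.exists_add_eq (n := n) (t := t)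
  refine ⟨fun c => ∑ γ, c γ • Matrix.single (a γ) (b γ) 1, by fun_prop, by simp, fun c x => ?_⟩
  rw [sum_mulVec, dotProduct_sum]
  refine Finset.sum_congr rfl fun γ _ => ?_
  rw [smul_mulVec, dotProduct_smul, smul_eq_mul]
  conv_lhs => rw [← hab γ, mon_add, hab]
  rw [dotProduct_single_one_mulVec]

lemma mem_SOSCone_of_evalC_eq {c : MIdx n (2 * t) → ℝ} {Q : Matrix (MIdx n t) (MIdx n t) ℝ}
    (hQ : ∀ v, 0 ≤ v ⬝ᵥ Q *ᵥ v) (hc : ∀ x, evalC c x = mon x ⬝ᵥ Q *ᵥ mon x) :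
    c ∈ SOSCone n t := by
  obtain ⟨B, hB⟩ := exists_dotProduct_mulVec_eq_sum_sq hQ
  refine ⟨Fintype.card (MIdx n t), fun j => B ((Fintype.equivFin _).symm j), fun x => ?_⟩
  rw [hc, hB, ← (Fintype.equivFin (MIdx n t)).symm.sum_comp]
  rfl

lemma exists_posSemidef_of_mem_SOSCone {c : MIdx n (2 * t) → ℝ} (hc : c ∈ SOSCone n t) :
    ∃ Q : Matrix (MIdx n t) (MIdx n t) ℝ, Q.PosSemidef ∧
      ∀ x, evalC c x = mon x ⬝ᵥ Q *ᵥ mon x := by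
  obtain ⟨k, q, hq⟩ := hc
  refine ⟨∑ j, vecMulVec (q j) (q j), posSemidef_sum _ fun j _ => ?_, fun x => ?_⟩
  · simpa using posSemidef_vecMulVec_self_star (q j)
  · rw [hq, sum_mulVec, dotProduct_sum]
    refine Finset.sum_congr rfl fun j _ => ?_
    simp only [vecMulVec_mulVec, evalC_eq_dotProduct, sq]
    simp [dotProduct_smul, dotProduct_comm]

lemma exists_posDef_of_mem_interior_SOSCone {c : MIdx n (2 * t) → ℝ}
    (hc : c ∈ interior (SOSCone n t)) :
    ∃ Q : Matrix (MIdx n t) (MIdx n t) ℝ, Q.PosDef ∧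
      ∀ x, evalC c x = mon x ⬝ᵥ Q *ᵥ mon x := by
  obtain ⟨d, hd⟩ := exists_evalC_eq_mon_dotProduct_self n t
  have hlim : Tendsto (fun r : ℝ => c - r • d) (𝓝 0) (𝓝 c) := by
    have : Continuous fun r : ℝ => c - r • d := by fun_prop
    simpa using this.tendsto 0
  have hev : ∀ᶠ r : ℝ in 𝓝[>] 0, c - r • d ∈ SOSCone n t :=
    (hlim.eventually (mem_interior_iff_mem_nhds.mp hc)).filter_mono nhdsWithin_le_nhds
  obtain ⟨r, hr, hr0⟩ := (hev.and self_mem_nhdsWithin).exists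
  obtain ⟨Q, hQ, hQx⟩ := exists_posSemidef_of_mem_SOSCone hr
  refine ⟨Q + r • 1, PosDef.posSemidef_add hQ (PosDef.one.smul hr0), fun x => ?_⟩
  have := hQx x
  rw [evalC_sub, evalC_smul, hd] at this
  rw [add_mulVec, smul_mulVec, one_mulVec, dotProduct_add, dotProduct_smul, ← this, smul_eq_mul]
  ring

lemma exists_momMat_eq {P : Matrix (MIdx n t) (MIdx n t) ℝ} (hP : P.IsHermitian)
    (horth : ∀ E : Matrix (MIdx n t) (MIdx n t) ℝ, E.IsHermitian →
      (∀ x, mon x ⬝ᵥ E *ᵥ mon x = 0) → (P * E).trace = 0) :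
    ∃ φ : (Fin n → ℕ) → ℝ, momMat n t φ = P := by
  have hHankel : ∀ α β α' β' : MIdx n t, α.add β = α'.add β' → P α β = P α' β' := by
    intro α β α' β' h
    have key := horth (Matrix.single α β 1 + Matrix.single β α 1
      - (Matrix.single α' β' 1 + Matrix.single β' α' 1)) ?_ fun x => ?_
    · have h1 : P β α = P α β := by simpa using hP.apply α β
      have h2 : P β' α' = P α' β' := by simpa using hP.apply α' β'
      simp [mul_sub, mul_add, trace_mul_single] at key
      linarith
    · simp [IsHermitian, add_comm]
    · have hm := congrArg (mon x) h
      rw [mon_add, mon_add] at hm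
      simp only [sub_mulVec, add_mulVec, dotProduct_sub, dotProduct_add,
        dotProduct_single_one_mulVec]
      linarith
  classical
  refine ⟨fun g => if h : ∃ αβ : MIdx n t × MIdx n t,
    (fun i => (αβ.1.1 i : ℕ) + (αβ.2.1 i : ℕ)) = g then P h.choose.1 h.choose.2 else 0, ?_⟩
  ext α β
  have h : ∃ αβ : MIdx n t × MIdx n t, (fun i => (αβ.1.1 i : ℕ) + (αβ.2.1 i : ℕ)) =
    fun i => (α.1 i : ℕ) + (β.1 i : ℕ) := ⟨(α, β), rfl⟩
  rw [momMat, dif_pos h]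
  exact hHankel _ _ _ _ (MIdx.ext_nat fun i => congrFun h.choose_spec i)

end Monomials

/-- An `n`-variate polynomial `p ∈ ℝ[x]_{2t}` lies in the interior of the SOS cone `Σ[x]_t`
if and only if there is a sequence `φ` with positive definite moment matrix `M_t(φ)` such
that `p(x) = v_t(x)ᵀ M_t(φ)⁻¹ v_t(x)` for all `x`; i.e. `1/p` is the Christoffel function
of the linear functional `L_φ`. -/
theorem stmt0 (n t : ℕ) (c : MIdx n (2 * t) → ℝ) :
    c ∈ interior (SOSCone n t) ↔
      ∃ φ : (Fin n → ℕ) → ℝ, (momMat n t φ).PosDef ∧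
        ∀ x : Fin n → ℝ,
          evalC c x = mon x ⬝ᵥ (momMat n t φ)⁻¹.mulVec (mon x) := by
  constructor
  · intro hc
    obtain ⟨Q₀, hQ₀, hQ₀x⟩ := exists_posDef_of_mem_interior_SOSCone hc
    obtain ⟨Q, ⟨hQ, hQx⟩, hmax⟩ :=
      (isCompact_setOf_posSemidef_forall_eq (span_range_mon (n := n) (t := t))
        (evalC c)).exists_isMaxOn ⟨Q₀, hQ₀.posSemidef, hQ₀x⟩ continuous_id.matrix_det.continuousOn
    have hdet : 0 < Q.det := hQ₀.det_pos.trans_le (hmax ⟨hQ₀.posSemidef, hQ₀x⟩)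
    have hQ : Q.PosDef := hQ.posDef_iff_det_ne_zero.mpr hdet.ne'
    obtain ⟨φ, hφ⟩ := exists_momMat_eq hQ.inv.isHermitian fun E hE hEx => by
      refine hQ.trace_inv_mul_eq_zero_of_det_le ?_
      have hlim : Tendsto (fun r : ℝ => Q + r • E) (𝓝 0) (𝓝 Q) := by
        have : Continuous fun r : ℝ => Q + r • E := by fun_prop
        simpa using this.tendsto 0
      have hpos : ∀ v : MIdx n t → ℝ, v ≠ 0 → 0 < v ⬝ᵥ Q *ᵥ v := fun v hv => by
        simpa using hQ.dotProduct_mulVec_pos hv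
      filter_upwards [hlim.eventually (eventually_forall_dotProduct_mulVec_pos hpos)] with r hr
      refine hmax ⟨(PosDef.of_dotProduct_mulVec_pos ?_ fun v hv => ?_).posSemidef, fun x => ?_⟩
      · exact hQ.isHermitian.add (hE.smul (IsSelfAdjoint.all r))
      · simpa using hr v hv
      · rw [add_mulVec, smul_mulVec, dotProduct_add, dotProduct_smul, hEx, smul_zero, add_zero,
          hQx]
    refine ⟨φ, hφ ▸ hQ.inv, fun x => ?_⟩
    rw [hφ, nonsing_inv_nonsing_inv _ hdet.ne'.isUnit, hQx]
  · rintro ⟨φ, hφ, hx⟩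
    obtain ⟨S, hS, hS0, hSx⟩ := exists_continuous_evalC_eq n t
    have hlim : Tendsto (fun d => (momMat n t φ)⁻¹ + S (d - c)) (𝓝 c) (𝓝 (momMat n t φ)⁻¹) := by
      have : Continuous fun d => (momMat n t φ)⁻¹ + S (d - c) := by fun_prop
      simpa [hS0] using this.tendsto c
    have hpos : ∀ v : MIdx n t → ℝ, v ≠ 0 → 0 < v ⬝ᵥ (momMat n t φ)⁻¹ *ᵥ v := fun v hv => by
      simpa using hφ.inv.dotProduct_mulVec_pos hv
    rw [mem_interior_iff_mem_nhds]
    filter_upwards [hlim.eventually (eventually_forall_dotProduct_mulVec_pos hpos)] with d hd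
    refine mem_SOSCone_of_evalC_eq (Q := (momMat n t φ)⁻¹ + S (d - c)) (fun v => ?_) fun x => ?_
    · rcases eq_or_ne v 0 with rfl | hv
      · simp
      · exact (hd v hv).le
    · rw [add_mulVec, dotProduct_add, ← hSx, ← hx, evalC_sub, add_sub_cancel]
end
end

section
/- If a univariate polynomial p ∈ ℝ[x]_{2t} lies in the interior of the SOS cone Σ[x]_t, then there exists a Borel measure φ on ℝ with finite moments up to order 2t whose moment matrix M_t(φ) is positive definite and such that p(x) = v_t(x)^T M_t(φ)^{-1} v_t(x) for all x ∈ ℝ; that is, 1/p is the Christoffel function Λ^φ_t of a measure φ on the real line. -/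
open MeasureTheory Matrix Filter Topology

noncomputable section

/-- The vector `v_t(y) = (1, y, …, y^t)` of univariate monomials of degree at most `t`. -/
def vU (t : ℕ) (y : ℝ) : Fin (t + 1) → ℝ := fun i => y ^ (i : ℕ)

/-- Evaluation at `y` of the univariate polynomial with coefficient vector `c`. -/
def evalU {t : ℕ} (c : Fin (t + 1) → ℝ) (y : ℝ) : ℝ :=
  ∑ i, c i * y ^ (i : ℕ)

/-- The (Hankel) moment matrix `M_t(φ)` of a sequence `φ = (φ_k)`, with entries `φ_{i+j}`. -/
def hankel (t : ℕ) (φ : ℕ → ℝ) : Matrix (Fin (t + 1)) (Fin (t + 1)) ℝ :=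
  fun i j => φ ((i : ℕ) + (j : ℕ))

/-- Moments of a Borel measure on `ℝ`. -/
def momSeqU (ν : Measure ℝ) : ℕ → ℝ := fun k => ∫ y, y ^ k ∂ν

/-- The cone `Σ[x]_t` of univariate sum-of-squares polynomials of degree at most `2t`,
viewed as a set of coefficient vectors (coordinates of `ℝ[x]_{2t}`). -/
def SOSConeU (t : ℕ) : Set (Fin (2 * t + 1) → ℝ) :=
  {c | ∃ (k : ℕ) (q : Fin k → Fin (t + 1) → ℝ),
     ∀ y : ℝ, evalU c y = ∑ j, (evalU (q j) y) ^ 2}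

open scoped MatrixOrder in
/-- A positive definite real matrix factors as `Bᵀ * B` with `B` invertible. -/
lemma posDef_exists_transpose_mul_self {n : Type*} [Fintype n] [DecidableEq n]
    {M : Matrix n n ℝ} (hM : M.PosDef) : ∃ B : Matrix n n ℝ, IsUnit B ∧ M = Bᵀ * B := by
  obtain ⟨B, hB, h⟩ := CStarAlgebra.isStrictlyPositive_iff_eq_star_mul_self.mp
    hM.isStrictlyPositive
  exact ⟨B, hB, by simpa [star_eq_conjTranspose] using h⟩

/-- The numbers `uᵀ Aᵏ u` are the moments of a finitely atomic measure when `A` is symmetric. -/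
lemma isHermitian_dotProduct_pow_mulVec {n : Type*} [Fintype n] [DecidableEq n]
    {A : Matrix n n ℝ} (hA : A.IsHermitian) (u : n → ℝ) :
    ∃ w x : n → ℝ, (∀ m, 0 ≤ w m) ∧ ∀ k : ℕ, u ⬝ᵥ (A ^ k) *ᵥ u = ∑ m, w m * x m ^ k := by
  set U : Matrix n n ℝ := (hA.eigenvectorUnitary : Matrix n n ℝ)
  refine ⟨fun m => (Uᵀ *ᵥ u) m ^ 2, hA.eigenvalues, fun m => sq_nonneg _, fun k => ?_⟩
  have h : A ^ k = U * diagonal (fun m => hA.eigenvalues m ^ k) * Uᵀ := by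
    conv_lhs => rw [hA.spectral_theorem, ← map_pow, diagonal_pow]
    rw [Unitary.conjStarAlgAut_apply]
    rfl
  rw [h, ← mulVec_mulVec, ← mulVec_mulVec, dotProduct_mulVec, ← mulVec_transpose]
  simp only [dotProduct, mulVec_diagonal]
  exact Finset.sum_congr rfl fun m _ => by ring

/-- The moment matrix of a truncated sequence, as a linear map. -/
def truncHankel (t : ℕ) :
    (Fin (2 * t + 1) → ℝ) →ₗ[ℝ] Matrix (Fin (t + 1)) (Fin (t + 1)) ℝ where
  toFun φ := of fun i j => φ ⟨(i : ℕ) + j, by omega⟩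
  map_add' _ _ := rfl
  map_smul' _ _ := rfl

lemma truncHankel_apply (t : ℕ) (φ : Fin (2 * t + 1) → ℝ) (i j : Fin (t + 1)) :
    truncHankel t φ i j = φ ⟨(i : ℕ) + j, by omega⟩ := rfl

lemma isHermitian_truncHankel (t : ℕ) (φ : Fin (2 * t + 1) → ℝ) :
    (truncHankel t φ).IsHermitian := by
  ext i j
  simp [truncHankel_apply, add_comm]

lemma continuous_truncHankel (t : ℕ) : Continuous (truncHankel t) :=
  (truncHankel t).continuous_of_finiteDimensional

lemma truncHankel_vU (t : ℕ) (y : ℝ) :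
    truncHankel t (vU (2 * t) y) = vecMulVec (vU t y) (vU t y) := by
  ext i j
  simp [truncHankel_apply, vU, vecMulVec_apply, pow_add]

/-- **Truncated Hamburger moment problem**: a truncated sequence with positive definite moment
matrix is represented by a finitely atomic measure. -/
lemma exists_atoms_of_posDef_truncHankel {t : ℕ} {φ : Fin (2 * t + 1) → ℝ}
    (h : (truncHankel t φ).PosDef) :
    ∃ w x : Fin (t + 1) → ℝ, (∀ m, 0 ≤ w m) ∧
      ∀ k : Fin (2 * t + 1), φ k = ∑ m, w m * x m ^ (k : ℕ) := by
  obtain ⟨B, hB, hM⟩ := posDef_exists_transpose_mul_self h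
  have hdet : IsUnit B.det := (isUnit_iff_isUnit_det B).mp hB
  have hdetT : IsUnit Bᵀ.det := by rwa [det_transpose]
  let N : Matrix (Fin (t + 1)) (Fin (t + 1)) ℝ :=
    of fun i j => if h : (i : ℕ) + j + 1 < 2 * t + 1 then φ ⟨(i : ℕ) + j + 1, h⟩ else 0
  have hN : Nᵀ = N := by
    ext i j
    simp [N, add_comm (i : ℕ)]
  set A := (Bᵀ)⁻¹ * N * B⁻¹ with hAdef
  have hAT : Aᵀ = A := by
    simp [A, transpose_mul, hN, transpose_nonsing_inv, mul_assoc]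
  have hA : A.IsHermitian := by simpa [IsHermitian] using hAT
  have hstep (k : ℕ) (hk : k + 1 < t + 1) :
      A *ᵥ B.col ⟨k, by omega⟩ = B.col ⟨k + 1, hk⟩ := by
    have hcol : N.col ⟨k, by omega⟩ = (Bᵀ * B).col ⟨k + 1, hk⟩ := by
      ext i
      rw [← hM]
      simp only [col_apply, truncHankel_apply, N, of_apply]
      rw [dif_pos (by omega)]
      rfl
    rw [← mulVec_single_one] at hcol ⊢
    rw [← mulVec_single_one] at hcol ⊢
    rw [hAdef, mulVec_mulVec, mul_assoc, mul_assoc, nonsing_inv_mul _ hdet, mul_one,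
      ← mulVec_mulVec, hcol, mulVec_mulVec, ← mul_assoc, nonsing_inv_mul _ hdetT, one_mul]
  have hpow (k : ℕ) (hk : k < t + 1) : (A ^ k) *ᵥ B.col 0 = B.col ⟨k, hk⟩ := by
    induction k with
    | zero => simp
    | succ k ih => rw [pow_succ', ← mulVec_mulVec, ih (by omega), hstep]
  obtain ⟨w, x, hw, hx⟩ := isHermitian_dotProduct_pow_mulVec hA (B.col 0)
  refine ⟨w, x, hw, fun k => ?_⟩
  have key (i j : ℕ) (hi : i < t + 1) (hj : j < t + 1) (hij : i + j = k) :
      φ k = ∑ m, w m * x m ^ (k : ℕ) := by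
    have h1 : truncHankel t φ ⟨i, hi⟩ ⟨j, hj⟩ = B.col ⟨i, hi⟩ ⬝ᵥ B.col ⟨j, hj⟩ := by
      rw [hM]
      rfl
    rw [← hpow i hi, ← hpow j hj, dotProduct_mulVec, ← mulVec_transpose, transpose_pow, hAT,
      mulVec_mulVec, ← pow_add, dotProduct_comm, add_comm j, hij, hx] at h1
    rw [← h1, truncHankel_apply]
    exact congrArg φ (Fin.ext hij.symm)
  have hk := k.isLt
  exact key (min (k : ℕ) t) (k - min (k : ℕ) t) (by omega) (by omega) (by omega)

/-- The polynomial with coefficient vector `c`. -/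
def polyU {n : ℕ} (c : Fin (n + 1) → ℝ) : Polynomial ℝ :=
  ∑ i : Fin (n + 1), Polynomial.monomial (i : ℕ) (c i)

lemma eval_polyU {n : ℕ} (c : Fin (n + 1) → ℝ) (y : ℝ) : (polyU c).eval y = evalU c y := by
  simp [polyU, evalU, Polynomial.eval_finsetSum]

/-- The Riesz functional of a truncated sequence. -/
def rieszU {n : ℕ} (φ : Fin (n + 1) → ℝ) : Polynomial ℝ →ₗ[ℝ] ℝ :=
  ∑ k, φ k • Polynomial.lcoeff ℝ (k : ℕ)

lemma rieszU_monomial {n : ℕ} (φ : Fin (n + 1) → ℝ) (k : Fin (n + 1)) (a : ℝ) :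
    rieszU φ (Polynomial.monomial (k : ℕ) a) = a * φ k := by
  simp [rieszU, Polynomial.coeff_monomial, Fin.val_inj, mul_comm]

lemma rieszU_polyU {n : ℕ} (φ c : Fin (n + 1) → ℝ) : rieszU φ (polyU c) = c ⬝ᵥ φ := by
  simp [polyU, rieszU_monomial, dotProduct]

lemma rieszU_polyU_sq {t : ℕ} (φ : Fin (2 * t + 1) → ℝ) (q : Fin (t + 1) → ℝ) :
    rieszU φ (polyU q ^ 2) = q ⬝ᵥ truncHankel t φ *ᵥ q := by
  rw [sq, polyU, Finset.sum_mul_sum]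
  simp only [Polynomial.monomial_mul_monomial, map_sum, dotProduct, mulVec, Finset.mul_sum]
  refine Finset.sum_congr rfl fun i _ => Finset.sum_congr rfl fun j _ => ?_
  rw [show (i : ℕ) + j = ((⟨(i : ℕ) + j, by omega⟩ : Fin (2 * t + 1)) : ℕ) from rfl,
    rieszU_monomial, truncHankel_apply]
  ring

lemma dotProduct_nonneg_of_mem_SOSConeU {t : ℕ} {c φ : Fin (2 * t + 1) → ℝ}
    (hc : c ∈ SOSConeU t) (hφ : (truncHankel t φ).PosSemidef) : 0 ≤ c ⬝ᵥ φ := by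
  obtain ⟨k, q, hq⟩ := hc
  have h : polyU c = ∑ j, polyU (q j) ^ 2 := by
    refine Polynomial.funext fun y => ?_
    simp [Polynomial.eval_finsetSum, eval_polyU, hq]
  rw [← rieszU_polyU, h, map_sum]
  refine Finset.sum_nonneg fun j _ => ?_
  rw [rieszU_polyU_sq]
  simpa using hφ.dotProduct_mulVec_nonneg (q j)

lemma exists_bound_of_mem_interior_SOSConeU {t : ℕ} {c : Fin (2 * t + 1) → ℝ}
    (hc : c ∈ interior (SOSConeU t)) :
    ∃ ε > 0, ∀ φ, (truncHankel t φ).PosSemidef → ∀ k, ε * |φ k| ≤ c ⬝ᵥ φ := by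
  obtain ⟨δ, hδ, hball⟩ := Metric.isOpen_iff.mp isOpen_interior c hc
  refine ⟨δ / 2, by positivity, fun φ hφ k => ?_⟩
  have key (s : ℝ) (hs : |s| < δ) : 0 ≤ c ⬝ᵥ φ + s * φ k := by
    have hmem : c + Pi.single k s ∈ SOSConeU t := by
      refine interior_subset (hball ?_)
      simpa [Metric.mem_ball, dist_eq_norm, Pi.norm_single] using hs
    simpa [add_dotProduct] using dotProduct_nonneg_of_mem_SOSConeU hmem hφ
  have h1 := key (δ / 2) (by rw [abs_of_pos (by positivity)]; linarith)
  have h2 := key (-(δ / 2)) (by rw [abs_neg, abs_of_pos (by positivity)]; linarith)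
  rcases abs_cases (φ k) with ⟨h, _⟩ | ⟨h, _⟩ <;> rw [h] <;> linarith

/-- Positive definiteness persists under small symmetric perturbations. -/
lemma eventually_posDef_add_smul {n : Type*} [Fintype n] {M H : Matrix n n ℝ}
    (hM : M.PosDef) (hH : H.IsHermitian) : ∀ᶠ s : ℝ in 𝓝 0, (M + s • H).PosDef := by
  have hcont : Continuous fun p : ℝ × (n → ℝ) => p.2 ⬝ᵥ (M + p.1 • H) *ᵥ p.2 := by fun_prop
  have hev : ∀ᶠ s : ℝ in 𝓝 0, ∀ x ∈ Metric.sphere (0 : n → ℝ) 1,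
      0 < x ⬝ᵥ (M + s • H) *ᵥ x := by
    refine (isCompact_sphere _ _).eventually_forall_of_forall_eventually fun x hx => ?_
    refine (hcont.tendsto (0, x)).eventually (lt_mem_nhds ?_)
    have hx0 : x ≠ 0 := ne_zero_of_mem_unit_sphere ⟨x, hx⟩
    simpa using hM.dotProduct_mulVec_pos hx0
  filter_upwards [hev] with s hs
  refine PosDef.of_dotProduct_mulVec_pos (hM.isHermitian.add ?_) fun x hx => ?_
  · rw [IsHermitian, conjTranspose_smul, hH.eq, star_trivial]
  · have hn : 0 < ‖x‖ := norm_pos_iff.mpr hx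
    have h := hs (‖x‖⁻¹ • x) (by simp [norm_smul, hn.ne'])
    simp only [mulVec_smul, dotProduct_smul, smul_dotProduct, smul_eq_mul] at h
    have h2 := pos_of_mul_pos_right h (inv_nonneg.mpr hn.le)
    simpa using pos_of_mul_pos_right h2 (inv_nonneg.mpr hn.le)

lemma exists_posDef_truncHankel (t : ℕ) : ∃ φ, (truncHankel t φ).PosDef := by
  let V : Matrix (Fin (t + 1)) (Fin (t + 1)) ℝ := vandermonde fun m => (m : ℝ)
  refine ⟨fun k => ∑ m : Fin (t + 1), (m : ℝ) ^ (k : ℕ), ?_⟩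
  have hV : IsUnit V := by
    rw [isUnit_iff_isUnit_det, isUnit_iff_ne_zero, det_vandermonde_ne_zero_iff]
    intro a b hab
    exact Fin.ext (Nat.cast_injective hab)
  have h := PosDef.conjTranspose_mul_self V (mulVec_injective_iff_isUnit.mpr hV)
  convert h using 1
  ext i j
  rw [conjTranspose_eq_transpose_of_trivial, vandermonde_transpose_mul_vandermonde]
  rfl

/-- If `det (1 + s X) ≤ 1` for all small `s`, then `X` has trace zero. -/
lemma trace_eq_zero_of_eventually_det_le_one {n : Type*} [Fintype n] [DecidableEq n]
    {X : Matrix n n ℝ} (h : ∀ᶠ s : ℝ in 𝓝 0, det (1 + s • X) ≤ 1) : X.trace = 0 := by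
  have hd : HasDerivAt (fun s : ℝ => det (1 + s • X)) X.trace 0 := by
    let P := (det (1 + (Polynomial.X : Polynomial ℝ) • X.map Polynomial.C)).divX.divX
    have hdet : (fun s : ℝ => det (1 + s • X)) =
        fun s => 1 + X.trace * s + P.eval s * s ^ 2 := funext fun s => det_one_add_smul s X
    rw [hdet]
    have h1 := (((hasDerivAt_id (0 : ℝ)).const_mul X.trace).const_add 1).add
      ((P.hasDerivAt 0).mul ((hasDerivAt_id (0 : ℝ)).pow 2))
    exact h1.congr_deriv (by simp)
  have hmax : IsLocalMax (fun s : ℝ => det (1 + s • X)) 0 := by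
    filter_upwards [h] with s hs
    simpa using hs
  exact hmax.hasDerivAt_eq_zero hd

/-- There is a maximizer of the determinant over the normalized slice of the cone of truncated
sequences with positive semidefinite moment matrix. -/
lemma exists_posDef_isMaxOn_det {t : ℕ} {c : Fin (2 * t + 1) → ℝ}
    (hc : c ∈ interior (SOSConeU t)) :
    ∃ φ, (truncHankel t φ).PosDef ∧ c ⬝ᵥ φ = 1 ∧
      ∀ ψ, (truncHankel t ψ).PosSemidef → c ⬝ᵥ ψ = 1 →
        (truncHankel t ψ).det ≤ (truncHankel t φ).det := by
  obtain ⟨ε, hε, hbd⟩ := exists_bound_of_mem_interior_SOSConeU hc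
  let K : Set (Fin (2 * t + 1) → ℝ) := {φ | (truncHankel t φ).PosSemidef ∧ c ⬝ᵥ φ = 1}
  have hclosed : IsClosed K := by
    have hset : K = (⋂ x : Fin (t + 1) → ℝ, {φ | 0 ≤ x ⬝ᵥ truncHankel t φ *ᵥ x}) ∩
        {φ | c ⬝ᵥ φ = 1} := by
      ext φ
      have hH := isHermitian_truncHankel t φ
      simp [K, posSemidef_iff_dotProduct_mulVec, -isHermitian_iff_isSymm, hH]
    have hct := continuous_truncHankel t
    rw [hset]
    exact (isClosed_iInter fun x => isClosed_le continuous_const (by fun_prop)).inter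
      (isClosed_eq (by fun_prop) continuous_const)
  have hbounded : Bornology.IsBounded K := by
    refine (Metric.isBounded_closedBall (x := 0) (r := ε⁻¹)).subset fun φ hφ => ?_
    rw [mem_closedBall_zero_iff, pi_norm_le_iff_of_nonneg (by positivity)]
    intro k
    have := hbd φ hφ.1 k
    rw [hφ.2] at this
    rw [Real.norm_eq_abs, inv_eq_one_div, le_div_iff₀ hε]
    linarith
  have hK : IsCompact K := Metric.isCompact_of_isClosed_isBounded hclosed hbounded
  obtain ⟨φ₀, h₀⟩ := exists_posDef_truncHankel t
  have hpos : 0 < c ⬝ᵥ φ₀ := by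
    refine lt_of_lt_of_le (mul_pos hε (abs_pos.mpr ?_)) (hbd φ₀ h₀.posSemidef 0)
    exact (h₀.diag_pos (i := 0)).ne'
  have h₁ : (truncHankel t ((c ⬝ᵥ φ₀)⁻¹ • φ₀)).PosDef := by
    rw [map_smul]
    exact h₀.smul (inv_pos.mpr hpos)
  have h₁' : c ⬝ᵥ ((c ⬝ᵥ φ₀)⁻¹ • φ₀) = 1 := by
    rw [dotProduct_smul, smul_eq_mul, inv_mul_cancel₀ hpos.ne']
  have hcont : Continuous fun φ => (truncHankel t φ).det := (continuous_truncHankel t).matrix_det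
  obtain ⟨φ, hφ, hmax⟩ := hK.exists_isMaxOn ⟨_, h₁.posSemidef, h₁'⟩ hcont.continuousOn
  refine ⟨φ, ?_, hφ.2, fun ψ hψ hψ' => hmax ⟨hψ, hψ'⟩⟩
  rw [hφ.1.posDef_iff_det_ne_zero]
  exact (h₁.det_pos.trans_le (hmax ⟨h₁.posSemidef, h₁'⟩)).ne'

/-- First-order optimality of the determinant maximizer, after rescaling. -/
lemma exists_posDef_truncHankel_trace_eq {t : ℕ} {c : Fin (2 * t + 1) → ℝ}
    (hc : c ∈ interior (SOSConeU t)) :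
    ∃ φ, (truncHankel t φ).PosDef ∧
      ∀ ψ, ((truncHankel t φ)⁻¹ * truncHankel t ψ).trace = c ⬝ᵥ ψ := by
  obtain ⟨φ, hφ, hφc, hmax⟩ := exists_posDef_isMaxOn_det hc
  set M := truncHankel t φ with hMdef
  have hMdet : IsUnit M.det := hφ.det_pos.ne'.isUnit
  have hzero (η : Fin (2 * t + 1) → ℝ) (hη : c ⬝ᵥ η = 0) :
      (M⁻¹ * truncHankel t η).trace = 0 := by
    refine trace_eq_zero_of_eventually_det_le_one ?_
    filter_upwards [eventually_posDef_add_smul hφ (isHermitian_truncHankel t η)] with s hs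
    have hle := hmax (φ + s • η) (by simpa using hs.posSemidef)
      (by simp [dotProduct_add, hφc, hη])
    rw [map_add, map_smul, ← hMdef] at hle
    have hfac : M + s • truncHankel t η = M * (1 + s • (M⁻¹ * truncHankel t η)) := by
      rw [mul_add, mul_one, mul_smul_comm, mul_nonsing_inv_cancel_left _ _ hMdet]
    rw [hfac, det_mul] at hle
    exact le_of_mul_le_mul_left (by simpa using hle) hφ.det_pos
  have htr (ψ : Fin (2 * t + 1) → ℝ) :
      (M⁻¹ * truncHankel t ψ).trace = (t + 1) * (c ⬝ᵥ ψ) := by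
    have h := hzero (ψ - (c ⬝ᵥ ψ) • φ) (by simp [dotProduct_sub, hφc])
    rw [map_sub, map_smul, ← hMdef, mul_sub, mul_smul_comm, nonsing_inv_mul _ hMdet, trace_sub,
      trace_smul, trace_one, Fintype.card_fin, smul_eq_mul, sub_eq_zero] at h
    rw [h]
    push_cast
    ring
  have ht : (0 : ℝ) < t + 1 := by positivity
  refine ⟨((t : ℝ) + 1) • φ, ?_, fun ψ => ?_⟩
  · rw [map_smul]
    exact hφ.smul ht
  · have hinv : (((t : ℝ) + 1) • M)⁻¹ = ((t : ℝ) + 1)⁻¹ • M⁻¹ := by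
      refine inv_eq_left_inv ?_
      rw [smul_mul_smul_comm, nonsing_inv_mul _ hMdet, inv_mul_cancel₀ ht.ne', one_smul]
    rw [map_smul, ← hMdef, hinv, smul_mul_assoc, trace_smul, htr, smul_eq_mul,
      inv_mul_cancel_left₀ ht.ne']

/-- Moments of a finitely atomic measure on `ℝ`. -/
lemma integrable_and_integral_pow_atoms {ι : Type*} [Fintype ι] (w x : ι → ℝ)
    (hw : ∀ m, 0 ≤ w m) (k : ℕ) :
    Integrable (fun y : ℝ => y ^ k) (∑ m, ENNReal.ofReal (w m) • Measure.dirac (x m)) ∧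
      ∫ y, y ^ k ∂(∑ m, ENNReal.ofReal (w m) • Measure.dirac (x m)) = ∑ m, w m * x m ^ k := by
  have hint (m : ι) :
      Integrable (fun y : ℝ => y ^ k) (ENNReal.ofReal (w m) • Measure.dirac (x m)) :=
    (integrable_dirac (by simp)).smul_measure ENNReal.ofReal_ne_top
  refine ⟨integrable_finsetSum_measure.mpr fun m _ => hint m, ?_⟩
  rw [integral_finsetSum_measure fun m _ => hint m]
  simp [integral_smul_measure, ENNReal.toReal_ofReal, hw]

/-- If a univariate polynomial `p ∈ ℝ[x]_{2t}` lies in the interior of the SOS cone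
`Σ[x]_t`, then there is a Borel measure `φ` on `ℝ`, with finite moments up to order `2t`
and positive definite moment matrix `M_t(φ)`, such that
`p(y) = v_t(y)ᵀ M_t(φ)⁻¹ v_t(y)` for all `y ∈ ℝ`; that is, `1/p` is the Christoffel
function `Λ^φ_t` of a measure `φ` on the real line. -/
theorem stmt1 (t : ℕ) (c : Fin (2 * t + 1) → ℝ) (hc : c ∈ interior (SOSConeU t)) :
    ∃ φ : Measure ℝ,
      (∀ k ≤ 2 * t, Integrable (fun y : ℝ => y ^ k) φ) ∧
      (hankel t (momSeqU φ)).PosDef ∧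
      ∀ y : ℝ, evalU c y = vU t y ⬝ᵥ (hankel t (momSeqU φ))⁻¹.mulVec (vU t y) := by
  obtain ⟨φ, hφ, htr⟩ := exists_posDef_truncHankel_trace_eq hc
  obtain ⟨w, x, hw, hx⟩ := exists_atoms_of_posDef_truncHankel hφ
  have hmom := integrable_and_integral_pow_atoms w x hw
  refine ⟨∑ m, ENNReal.ofReal (w m) • Measure.dirac (x m), fun k _ => (hmom k).1, ?_⟩
  have hH : hankel t (momSeqU (∑ m, ENNReal.ofReal (w m) • Measure.dirac (x m))) =
      truncHankel t φ := by
    ext i j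
    rw [truncHankel_apply, hx]
    exact (hmom _).2
  rw [hH]
  refine ⟨hφ, fun y => ?_⟩
  have h := htr (vU (2 * t) y)
  rw [truncHankel_vU, mul_vecMulVec, trace_vecMulVec, dotProduct_comm] at h
  rw [h]
  rfl
end
end

section
/- Let μ be a Borel measure on a compact set Ω ⊂ X×Y ⊂ ℝⁿ×ℝ with nonempty interior (so that M_t(μ) is positive definite for all t), and let φ be the marginal of μ on ℝⁿ. Then for every x ∈ ℝⁿ and every t ∈ ℕ there exists a Borel measure ν_{x,t} on ℝ, with finite moments up to order 2t and positive definite moment matrix M_t(ν_{x,t}), such that Λ^μ_t(x,y) = Λ^φ_t(x) · Λ^{ν_{x,t}}_t(y) for all y ∈ ℝ. -/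
open MeasureTheory Matrix

noncomputable section

/-- Joint multi-indices `(α, k) ∈ ℕⁿ × ℕ` with `|α| + k ≤ t`, indexing the monomials
`x^α y^k` of degree at most `t` on `ℝⁿ × ℝ`. -/
def XYIdx (n t : ℕ) : Type :=
  {ak : (Fin n → Fin (t + 1)) × Fin (t + 1) //
    (∑ i, ((ak.1 i : ℕ))) + (ak.2 : ℕ) ≤ t}

instance (n t : ℕ) : Fintype (XYIdx n t) := by unfold XYIdx; infer_instance

instance (n t : ℕ) : DecidableEq (XYIdx n t) := by unfold XYIdx; infer_instance

/-- The monomial `x^α y^k`. -/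
def monXY {n t : ℕ} (x : Fin n → ℝ) (y : ℝ) (γ : XYIdx n t) : ℝ :=
  (∏ i, x i ^ ((γ.1.1 i : ℕ))) * y ^ ((γ.1.2 : ℕ))

/-- The moment matrix `M_t(μ)` of a measure `μ` on `ℝⁿ × ℝ`. -/
def momMatXY (n t : ℕ) (μ : Measure ((Fin n → ℝ) × ℝ)) :
    Matrix (XYIdx n t) (XYIdx n t) ℝ :=
  fun γ δ => ∫ z, monXY z.1 z.2 γ * monXY z.1 z.2 δ ∂μ

/-- The moment matrix `M_t(φ)` of a measure `φ` on `ℝⁿ`. -/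
def momMatX (n t : ℕ) (φ : Measure (Fin n → ℝ)) : Matrix (MIdx n t) (MIdx n t) ℝ :=
  fun α β => ∫ x, mon x α * mon x β ∂φ

/-- The Hankel moment matrix `M_t(ν)` of a measure `ν` on `ℝ`. -/
def hankelM (t : ℕ) (ν : Measure ℝ) : Matrix (Fin (t + 1)) (Fin (t + 1)) ℝ :=
  fun i j => ∫ y, y ^ ((i : ℕ) + (j : ℕ)) ∂ν

/-- The Christoffel function `Λ^μ_t(x,y)` of a measure `μ` on `ℝⁿ × ℝ`. -/
def CFXY (n t : ℕ) (μ : Measure ((Fin n → ℝ) × ℝ)) (x : Fin n → ℝ) (y : ℝ) : ℝ :=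
  (monXY x y ⬝ᵥ (momMatXY n t μ)⁻¹.mulVec (monXY x y))⁻¹

/-- The Christoffel function `Λ^φ_t(x)` of a measure `φ` on `ℝⁿ`. -/
def CFX (n t : ℕ) (φ : Measure (Fin n → ℝ)) (x : Fin n → ℝ) : ℝ :=
  (mon x ⬝ᵥ (momMatX n t φ)⁻¹.mulVec (mon x))⁻¹

/-- The Christoffel function `Λ^ν_t(y)` of a measure `ν` on `ℝ`. -/
def CFY (t : ℕ) (ν : Measure ℝ) (y : ℝ) : ℝ :=
  ((fun i : Fin (t + 1) => y ^ (i : ℕ)) ⬝ᵥ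
    (hankelM t ν)⁻¹.mulVec (fun i : Fin (t + 1) => y ^ (i : ℕ)))⁻¹

open scoped MatrixOrder Matrix.Norms.L2Operator in
/-- A real positive definite matrix is of the form `Bᵀ * B` with `B` invertible. -/
lemma exists_isUnit_det_transpose_mul_self {m : Type*} [Fintype m] [DecidableEq m]
    {H : Matrix m m ℝ} (hH : H.PosDef) :
    ∃ B : Matrix m m ℝ, IsUnit B.det ∧ H = Bᵀ * B := by
  obtain ⟨B, hB⟩ := CStarAlgebra.nonneg_iff_eq_star_mul_self.mp hH.posSemidef.nonneg
  have hB' : H = Bᵀ * B := by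
    rw [hB, star_eq_conjTranspose, conjTranspose_eq_transpose_of_trivial]
  refine ⟨B, ?_, hB'⟩
  have h := hH.det_pos.ne'
  rw [hB', det_mul, det_transpose] at h
  exact isUnit_iff_ne_zero.mpr (left_ne_zero_of_mul h)

/-- The entries of the matrix only depend on the sum of the two indices. -/
def IsHankel {t : ℕ} (H : Matrix (Fin (t + 1)) (Fin (t + 1)) ℝ) : Prop :=
  ∀ i j k l : Fin (t + 1), (i : ℕ) + j = k + l → H i j = H k l

lemma IsHankel.exists_seq {t : ℕ} {H : Matrix (Fin (t + 1)) (Fin (t + 1)) ℝ}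
    (hH : IsHankel H) : ∃ m : ℕ → ℝ, ∀ i j : Fin (t + 1), H i j = m (i + j) := by
  refine ⟨fun k => H (Fin.ofNat (t + 1) (k - t)) (Fin.ofNat (t + 1) (min k t)), fun i j => ?_⟩
  apply hH
  have hi := i.2
  have hj := j.2
  simp only [Fin.ofNat]
  rw [Nat.mod_eq_of_lt (by omega), Nat.mod_eq_of_lt (by omega)]
  omega

/-- A positive definite Hankel matrix is the moment matrix of an atomic measure, the spectral
measure of the compression of multiplication by the variable to polynomials of degree at most
`t`. -/
lemma IsHankel.exists_measure {t : ℕ} {H : Matrix (Fin (t + 1)) (Fin (t + 1)) ℝ}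
    (hH : IsHankel H) (hpd : H.PosDef) :
    ∃ ν : Measure ℝ, (∀ k : ℕ, Integrable (fun y : ℝ => y ^ k) ν) ∧ hankelM t ν = H := by
  obtain ⟨m, hm⟩ := hH.exists_seq
  obtain ⟨B, hBu, hB⟩ := exists_isUnit_det_transpose_mul_self hpd
  let S : Matrix (Fin (t + 1)) (Fin (t + 1)) ℝ := fun i j => m (i + j + 1)
  have hST : Sᵀ = S := by
    ext i j
    change m (j + i + 1) = m (i + j + 1)
    rw [add_comm (j : ℕ)]
  let A := (B⁻¹)ᵀ * S * B⁻¹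
  have hA : A.IsHermitian := by
    simp only [A, IsHermitian, conjTranspose_eq_transpose_of_trivial, transpose_mul,
      transpose_transpose, hST, Matrix.mul_assoc]
  have hAB : A * B = (B⁻¹)ᵀ * S := by
    simp only [A]
    rw [Matrix.mul_assoc, nonsing_inv_mul _ hBu, Matrix.mul_one]
  have hBH : (B⁻¹)ᵀ * H = B := by
    rw [hB, ← Matrix.mul_assoc, ← transpose_mul, mul_nonsing_inv _ hBu, transpose_one,
      Matrix.one_mul]
  let U : Matrix (Fin (t + 1)) (Fin (t + 1)) ℝ := hA.eigenvectorUnitary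
  have hU₁ : Uᵀ * U = 1 := by
    have := Unitary.coe_star_mul_self hA.eigenvectorUnitary
    rwa [star_eq_conjTranspose, conjTranspose_eq_transpose_of_trivial] at this
  have hU₂ : U * Uᵀ = 1 := mul_eq_one_comm.mp hU₁
  have hspec : A = U * diagonal hA.eigenvalues * Uᵀ := by
    have := hA.spectral_theorem
    rw [Unitary.conjStarAlgAut_apply, star_eq_conjTranspose,
      conjTranspose_eq_transpose_of_trivial] at this
    exact this
  let C := Uᵀ * B
  have hC : H = Cᵀ * C := by
    simp only [C]
    rw [transpose_mul, transpose_transpose, Matrix.mul_assoc, ← Matrix.mul_assoc U, hU₂,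
      Matrix.one_mul, hB]
  have hDC : diagonal hA.eigenvalues * C = Uᵀ * (A * B) := by
    conv_rhs => rw [hspec]
    simp only [C, ← Matrix.mul_assoc, hU₁, Matrix.one_mul]
  have hstep : ∀ (i : ℕ) (hi : i + 1 < t + 1) (k : Fin (t + 1)),
      C k ⟨i + 1, hi⟩ = hA.eigenvalues k * C k ⟨i, by omega⟩ := by
    intro i hi k
    rw [← diagonal_mul, hDC, hAB]
    simp only [C]
    rw [mul_apply, mul_apply]
    refine Finset.sum_congr rfl fun l _ => ?_
    rw [← congrFun₂ hBH, mul_apply, mul_apply]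
    congr 1
    refine Finset.sum_congr rfl fun r _ => ?_
    rw [hm]
    simp only [S, add_assoc]
  have hpow : ∀ (i : ℕ) (hi : i < t + 1) (k : Fin (t + 1)),
      C k ⟨i, hi⟩ = hA.eigenvalues k ^ i * C k 0 := by
    intro i
    induction i with
    | zero => intro hi k; simp
    | succ i ih => intro hi k; rw [hstep i hi, ih, pow_succ]; ring
  have hInt : ∀ k : ℕ, ∀ r ∈ (Finset.univ : Finset (Fin (t + 1))), Integrable (fun y : ℝ => y ^ k)
      (ENNReal.ofReal (C r 0 ^ 2) • Measure.dirac (hA.eigenvalues r)) := fun k r _ =>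
    (integrable_dirac (by simp)).smul_measure ENNReal.ofReal_ne_top
  refine ⟨∑ r, ENNReal.ofReal (C r 0 ^ 2) • Measure.dirac (hA.eigenvalues r),
    fun k => integrable_finsetSum_measure.mpr (hInt k), ?_⟩
  ext i j
  simp only [hankelM]
  rw [integral_finsetSum_measure (hInt _), hC, mul_apply]
  refine Finset.sum_congr rfl fun r _ => ?_
  rw [integral_smul_measure, integral_dirac, ENNReal.toReal_ofReal (sq_nonneg _), transpose_apply,
    hpow i i.2, hpow j j.2, smul_eq_mul, pow_add]
  ring

lemma Matrix.PosSemidef.abs_apply_le_trace {m : Type*} [Fintype m] [DecidableEq m]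
    {Y : Matrix m m ℝ} (hY : Y.PosSemidef) (i j : m) : |Y i j| ≤ Y.trace := by
  have hd : ∀ k, Y k k ≤ Y.trace := fun k =>
    Finset.single_le_sum (f := fun k => Y k k) (fun l _ => hY.diag_nonneg) (Finset.mem_univ k)
  have hs : Y j i = Y i j := by simpa using hY.1.apply i j
  have h₁ := hY.dotProduct_mulVec_nonneg (Pi.single i 1 + Pi.single j 1)
  have h₂ := hY.dotProduct_mulVec_nonneg (Pi.single i 1 - Pi.single j 1)
  simp only [star_trivial, mulVec_add, mulVec_sub, add_dotProduct, sub_dotProduct,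
    dotProduct_add, dotProduct_sub, mulVec_single_one, single_one_dotProduct, col_apply, hs]
    at h₁ h₂
  have := hd i
  have := hd j
  rw [abs_le]
  constructor <;> linarith

lemma isClosed_setOf_posSemidef_s8 {m : Type*} [Fintype m] :
    IsClosed {H : Matrix m m ℝ | H.PosSemidef} := by
  simp only [posSemidef_iff_dotProduct_mulVec, IsHermitian, Set.ofPred_and, Set.ofPred_forall]
  refine (isClosed_eq (by fun_prop) (by fun_prop)).inter (isClosed_iInter fun x => ?_)
  exact isClosed_le continuous_const (by fun_prop)

lemma isClosed_setOf_isHankel {t : ℕ} :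
    IsClosed {H : Matrix (Fin (t + 1)) (Fin (t + 1)) ℝ | IsHankel H} := by
  simp only [IsHankel, Set.ofPred_forall]
  exact isClosed_iInter fun i => isClosed_iInter fun j => isClosed_iInter fun k =>
    isClosed_iInter fun l => isClosed_iInter fun _ => isClosed_eq (by fun_prop) (by fun_prop)

lemma isCompact_hankel_slice {t : ℕ} {G : Matrix (Fin (t + 1)) (Fin (t + 1)) ℝ}
    (hG : G.PosDef) :
    IsCompact {H : Matrix (Fin (t + 1)) (Fin (t + 1)) ℝ |
      IsHankel H ∧ H.PosSemidef ∧ (G * H).trace = 1} := by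
  obtain ⟨C, hCu, hC⟩ := exists_isUnit_det_transpose_mul_self hG
  let box : Set (Matrix (Fin (t + 1)) (Fin (t + 1)) ℝ) :=
    Set.univ.pi fun _ => Set.univ.pi fun _ => Set.Icc (-1) 1
  have hbox : IsCompact box := isCompact_univ_pi fun _ => isCompact_univ_pi fun _ => isCompact_Icc
  have himg : IsCompact ((fun Y => C⁻¹ * Y * (C⁻¹)ᵀ) '' box) :=
    hbox.image (by fun_prop)
  refine himg.of_isClosed_subset ?_ ?_
  · exact isClosed_setOf_isHankel.inter
      (isClosed_setOf_posSemidef_s8.inter (isClosed_eq (by fun_prop) continuous_const))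
  · rintro H ⟨-, hpsd, htr⟩
    have hY : (C * H * Cᵀ).PosSemidef := by
      simpa [conjTranspose_eq_transpose_of_trivial] using hpsd.mul_mul_conjTranspose_same C
    have htrY : (C * H * Cᵀ).trace = 1 := by
      rw [trace_mul_comm, ← Matrix.mul_assoc, ← hC, htr]
    refine ⟨C * H * Cᵀ, fun i _ j _ => ?_, ?_⟩
    · have := hY.abs_apply_le_trace i j
      rw [htrY, abs_le] at this
      exact this
    · have h₁ : Cᵀ * (C⁻¹)ᵀ = 1 := by
        rw [← transpose_mul, nonsing_inv_mul _ hCu, transpose_one]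
      simp only [Matrix.mul_assoc, h₁, Matrix.mul_one]
      rw [← Matrix.mul_assoc, nonsing_inv_mul _ hCu, Matrix.one_mul]

/-- The maximal determinant over Hankel matrices normalised by `G`. -/
lemma exists_hankel_det_max {t : ℕ} {G : Matrix (Fin (t + 1)) (Fin (t + 1)) ℝ}
    (hG : G.PosDef) :
    ∃ H : Matrix (Fin (t + 1)) (Fin (t + 1)) ℝ, IsHankel H ∧ H.PosDef ∧ (G * H).trace = 1 ∧
      ∀ H', IsHankel H' → H'.PosSemidef → (G * H').trace = 1 → H'.det ≤ H.det := by
  let V := vandermonde (fun i : Fin (t + 1) => (i : ℝ))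
  have hV : V.det ≠ 0 := det_vandermonde_ne_zero_iff.mpr fun i j h => by
    simpa [Fin.ext_iff] using h
  have hVu : IsUnit V := (isUnit_iff_isUnit_det V).mpr (isUnit_iff_ne_zero.mpr hV)
  have hP : (Vᵀ * V).PosDef := by
    have := PosDef.conjTranspose_mul_self V (mulVec_injective_of_isUnit hVu)
    rwa [conjTranspose_eq_transpose_of_trivial] at this
  have hτ : 0 < (G * (Vᵀ * V)).trace := by
    have := hG.mul_mul_conjTranspose_same (B := V) (vecMul_injective_of_isUnit hVu)
    rw [conjTranspose_eq_transpose_of_trivial] at this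
    rw [← Matrix.mul_assoc, trace_mul_comm, ← Matrix.mul_assoc]
    exact this.trace_pos
  set τ := (G * (Vᵀ * V)).trace
  have hP' : (τ⁻¹ • (Vᵀ * V)).PosDef := hP.smul (inv_pos.mpr hτ)
  have hHank : IsHankel (τ⁻¹ • (Vᵀ * V)) := by
    intro i j k l h
    simp only [Matrix.smul_apply, V, vandermonde_transpose_mul_vandermonde, h]
  have htr : (G * (τ⁻¹ • (Vᵀ * V))).trace = 1 := by
    rw [Matrix.mul_smul, trace_smul, smul_eq_mul]
    exact inv_mul_cancel₀ hτ.ne'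
  obtain ⟨H, ⟨hH, hpsd, hHtr⟩, hmax⟩ := (isCompact_hankel_slice hG).exists_isMaxOn
    ⟨_, hHank, hP'.posSemidef, htr⟩ (f := fun H => H.det) (by fun_prop)
  refine ⟨H, hH, ?_, hHtr, fun H' h₁ h₂ h₃ => hmax ⟨h₁, h₂, h₃⟩⟩
  exact hpsd.posDef_iff_det_ne_zero.mpr (hP'.det_pos.trans_le (hmax ⟨hHank, hP'.posSemidef, htr⟩)).ne'

/-- A rank one perturbation of a positive definite matrix `H` is positive semidefinite as long as
its determinant stays nonnegative. -/
lemma Matrix.PosDef.add_smul_vecMulVec {m : Type*} [Fintype m] [DecidableEq m]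
    {H : Matrix m m ℝ} (hH : H.PosDef) (v : m → ℝ) {s : ℝ}
    (hs : 0 ≤ 1 + s * (v ⬝ᵥ H⁻¹ *ᵥ v)) : (H + s • vecMulVec v v).PosSemidef := by
  refine .of_dotProduct_mulVec_nonneg (hH.1.add ?_) fun x => ?_
  · ext i j
    simp [vecMulVec_apply, mul_comm]
  · have hHT : Hᵀ = H := by
      simpa [IsHermitian, conjTranspose_eq_transpose_of_trivial] using hH.1
    have hHu : IsUnit H.det := (isUnit_iff_isUnit_det H).mp hH.isUnit
    set a := v ⬝ᵥ H⁻¹ *ᵥ v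
    set c := v ⬝ᵥ x
    set q := x ⬝ᵥ H *ᵥ x
    have hq : 0 ≤ q := by simpa using hH.posSemidef.dotProduct_mulVec_nonneg x
    have ha : 0 ≤ a := by simpa using hH.inv.posSemidef.dotProduct_mulVec_nonneg v
    have hHw : H *ᵥ (H⁻¹ *ᵥ v) = v := by
      rw [mulVec_mulVec, mul_nonsing_inv _ hHu, one_mulVec]
    have hquad : ∀ r : ℝ, 0 ≤ a * (r * r) + (-2 * c) * r + q := fun r => by
      have h := hH.posSemidef.dotProduct_mulVec_nonneg (x - r • (H⁻¹ *ᵥ v))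
      have h₁ : (H⁻¹ *ᵥ v) ⬝ᵥ (H *ᵥ x) = c := by
        rw [dotProduct_mulVec, ← mulVec_transpose, hHT, hHw]
      simp only [star_trivial, mulVec_sub, mulVec_smul, hHw, sub_dotProduct, dotProduct_sub,
        smul_dotProduct, dotProduct_smul, h₁, smul_eq_mul, dotProduct_comm x v,
        dotProduct_comm (H⁻¹ *ᵥ v) v] at h
      linarith
    have hcs : c ^ 2 ≤ a * q := by
      have := discrim_le_zero hquad
      simp only [discrim] at this
      linarith
    have hval : star x ⬝ᵥ (H + s • vecMulVec v v) *ᵥ x = q + s * c ^ 2 := by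
      simp only [star_trivial, add_mulVec, smul_mulVec, vecMulVec_mulVec, dotProduct_add,
        dotProduct_smul, smul_eq_mul, op_smul_eq_smul, dotProduct_comm x v]
      simp only [q, c]
      ring
    rw [hval]
    rcases le_or_gt 0 s with h | h
    · positivity
    · nlinarith [mul_nonneg hq hs, mul_le_mul_of_nonpos_left hcs h.le]

lemma det_add_smul_vecMulVec {m : Type*} [Fintype m] [DecidableEq m]
    {H : Matrix m m ℝ} (hH : IsUnit H.det) (v : m → ℝ) (s : ℝ) :
    (H + s • vecMulVec v v).det = H.det * (1 + s * (v ⬝ᵥ H⁻¹ *ᵥ v)) := by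
  have h := det_add_replicateCol_mul_replicateRow (ι := Unit) hH (s • v) v
  rw [← vecMulVec_eq, smul_vecMulVec] at h
  rw [h, det_unique (n := Unit)]
  congr 1
  rw [Matrix.mul_assoc, Matrix.add_apply, one_apply_eq, mul_apply]
  simp only [replicateRow_apply, ← replicateCol_mulVec, replicateCol_apply, mulVec_smul,
    Pi.smul_apply, smul_eq_mul, dotProduct, Finset.mul_sum]
  congr 1
  exact Finset.sum_congr rfl fun i _ => by ring

lemma trace_mul_vecMulVec_self {m : Type*} [Fintype m] (G : Matrix m m ℝ) (v : m → ℝ) :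
    (G * vecMulVec v v).trace = v ⬝ᵥ G *ᵥ v := by
  rw [mul_vecMulVec, trace_vecMulVec, dotProduct_comm]

/-- Every positive definite quadratic form agrees on the moment curve with the inverse of a
positive definite Hankel matrix. -/
lemma exists_hankel_inv_eq {t : ℕ} {G : Matrix (Fin (t + 1)) (Fin (t + 1)) ℝ} (hG : G.PosDef) :
    ∃ H : Matrix (Fin (t + 1)) (Fin (t + 1)) ℝ, IsHankel H ∧ H.PosDef ∧
      ∀ y : ℝ, (fun i : Fin (t + 1) => y ^ (i : ℕ)) ⬝ᵥ
          H⁻¹ *ᵥ (fun i : Fin (t + 1) => y ^ (i : ℕ)) =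
        (fun i : Fin (t + 1) => y ^ (i : ℕ)) ⬝ᵥ G *ᵥ (fun i : Fin (t + 1) => y ^ (i : ℕ)) := by
  obtain ⟨H, hH, hpd, htr, hmax⟩ := exists_hankel_det_max hG
  have hHu : IsUnit H.det := (isUnit_iff_isUnit_det H).mp hpd.isUnit
  have hN : (0 : ℝ) < (t + 1 : ℕ) := by positivity
  have key : ∀ y : ℝ, (fun i : Fin (t + 1) => y ^ (i : ℕ)) ⬝ᵥ
        H⁻¹ *ᵥ (fun i : Fin (t + 1) => y ^ (i : ℕ)) = ((t + 1 : ℕ) : ℝ) *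
      ((fun i : Fin (t + 1) => y ^ (i : ℕ)) ⬝ᵥ
        G *ᵥ (fun i : Fin (t + 1) => y ^ (i : ℕ))) := by
    intro y
    set v := fun i : Fin (t + 1) => y ^ (i : ℕ) with hv
    set a := v ⬝ᵥ H⁻¹ *ᵥ v with ha
    set b := v ⬝ᵥ G *ᵥ v with hb
    have hloc : IsLocalMin (fun s : ℝ => (1 + s * b) ^ (t + 1) - (1 + s * a)) 0 := by
      have h₁ : ∀ᶠ s : ℝ in nhds 0, 0 < 1 + s * a :=
        ContinuousAt.eventually_lt (by fun_prop) (by fun_prop) (by simp)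
      have h₂ : ∀ᶠ s : ℝ in nhds 0, 0 < 1 + s * b :=
        ContinuousAt.eventually_lt (by fun_prop) (by fun_prop) (by simp)
      filter_upwards [h₁, h₂] with s hsa hsb
      have hpsd := hpd.add_smul_vecMulVec v (s := s) hsa.le
      have hdet := hmax ((1 + s * b)⁻¹ • (H + s • vecMulVec v v)) ?_
        (hpsd.smul (inv_nonneg.mpr hsb.le)) ?_
      · rw [det_smul, det_add_smul_vecMulVec hHu, Fintype.card_fin, ← ha, inv_pow,
          inv_mul_le_iff₀ (pow_pos hsb _), mul_comm] at hdet
        have := le_of_mul_le_mul_right hdet hpd.det_pos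
        simp only [zero_mul, add_zero, one_pow, sub_self]
        linarith
      · intro i j k l h
        simp only [Matrix.smul_apply, Matrix.add_apply, vecMulVec_apply, hv, ← pow_add, h,
          hH i j k l h]
      · rw [Matrix.mul_smul, trace_smul, Matrix.mul_add, trace_add, htr, Matrix.mul_smul,
          trace_smul, trace_mul_vecMulVec_self, ← hb, smul_eq_mul, smul_eq_mul]
        exact inv_mul_cancel₀ hsb.ne'
    have hlin : ∀ c : ℝ, HasDerivAt (fun s : ℝ => 1 + s * c) c 0 := fun c => by
      simpa using ((hasDerivAt_id (0 : ℝ)).mul_const c).const_add 1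
    have hder := hloc.hasDerivAt_eq_zero (((hlin b).pow (t + 1)).sub (hlin a))
    simp only [zero_mul, add_zero, one_pow, mul_one] at hder
    linarith
  refine ⟨((t + 1 : ℕ) : ℝ) • H, ?_, hpd.smul hN, fun y => ?_⟩
  · intro i j k l h
    simp only [Matrix.smul_apply, hH i j k l h]
  · have hinv : (((t + 1 : ℕ) : ℝ) • H)⁻¹ = ((t + 1 : ℕ) : ℝ)⁻¹ • H⁻¹ := by
      refine inv_eq_right_inv ?_
      rw [smul_mul_smul_comm, mul_inv_cancel₀ hN.ne', one_smul, mul_nonsing_inv _ hHu]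
    rw [hinv, smul_mulVec, dotProduct_smul, key, smul_eq_mul, inv_mul_cancel_left₀ hN.ne']

/-- The index of the monomial `x ^ α`, seen as a monomial in `(x, y)`. -/
def MIdx.toXY {n t : ℕ} (α : MIdx n t) : XYIdx n t := ⟨(α.1, 0), by simpa using α.2⟩

lemma MIdx.toXY_injective {n t : ℕ} : Function.Injective (MIdx.toXY : MIdx n t → XYIdx n t) :=
  fun _ _ h => Subtype.ext (congrArg (fun γ : XYIdx n t => γ.1.1) h)

lemma momMatX_map_fst (n t : ℕ) (μ : Measure ((Fin n → ℝ) × ℝ)) :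
    momMatX n t (μ.map Prod.fst) = (momMatXY n t μ).submatrix MIdx.toXY MIdx.toXY := by
  ext
  simp only [momMatX, momMatXY, submatrix_apply]
  rw [integral_map measurable_fst.aemeasurable]
  · simp [monXY, mon, MIdx.toXY]
  · refine Continuous.aestronglyMeasurable ?_
    unfold mon
    fun_prop

lemma CFX_map_fst_pos {n t : ℕ} {μ : Measure ((Fin n → ℝ) × ℝ)}
    (h : (momMatXY n t μ).PosDef) (x : Fin n → ℝ) : 0 < CFX n t (μ.map Prod.fst) x := by
  have hpd : (momMatX n t (μ.map Prod.fst)).PosDef := by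
    rw [momMatX_map_fst]
    exact h.submatrix MIdx.toXY_injective
  have hx : (mon x : MIdx n t → ℝ) ≠ 0 := fun h0 => by
    have h1 : mon x (⟨fun _ => 0, by simp⟩ : MIdx n t) = 0 := congrFun h0 _
    simp [mon] at h1
  exact inv_pos.mpr (by simpa using hpd.inv.dotProduct_mulVec_pos hx)

/-- The matrix expressing the monomials `x ^ α * y ^ k`, for fixed `x`, through powers of `y`. -/
def fiberMat {n : ℕ} (t : ℕ) (x : Fin n → ℝ) : Matrix (XYIdx n t) (Fin (t + 1)) ℝ :=
  fun γ k => if γ.1.2 = k then ∏ i, x i ^ (γ.1.1 i : ℕ) else 0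

lemma fiberMat_mulVec {n t : ℕ} (x : Fin n → ℝ) (w : Fin (t + 1) → ℝ) (γ : XYIdx n t) :
    (fiberMat t x *ᵥ w) γ = (∏ i, x i ^ (γ.1.1 i : ℕ)) * w γ.1.2 := by
  simp [fiberMat, mulVec, dotProduct]

lemma fiberMat_mulVec_injective {n t : ℕ} (x : Fin n → ℝ) :
    Function.Injective (fiberMat t x).mulVec := by
  intro v w h
  ext k
  let γ : XYIdx n t := ⟨(fun _ => 0, k), by simpa using k.is_le⟩
  have hγ := (fiberMat_mulVec x v γ).symm.trans ((congrFun h γ).trans (fiberMat_mulVec x w γ))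
  simpa [γ] using hγ

/-- Disintegration of the Christoffel function: if `μ` is a Borel measure on a compact
set `Ω ⊆ ℝⁿ × ℝ` with nonempty interior (so that `M_t(μ)` is positive definite for all
`t`), and `φ` is its marginal on `ℝⁿ`, then for every `x ∈ ℝⁿ` and `t ∈ ℕ` there is a
Borel measure `ν_{x,t}` on `ℝ`, with finite moments up to order `2t` and positive
definite moment matrix `M_t(ν_{x,t})`, such that
`Λ^μ_t(x,y) = Λ^φ_t(x) · Λ^{ν_{x,t}}_t(y)` for all `y ∈ ℝ`. -/
theorem stmt8 (n : ℕ) (Ω : Set ((Fin n → ℝ) × ℝ))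
    (hΩc : IsCompact Ω) (hΩi : (interior Ω).Nonempty)
    (μ : Measure ((Fin n → ℝ) × ℝ)) [IsFiniteMeasure μ] (hsupp : μ Ωᶜ = 0)
    (hPD : ∀ s : ℕ, (momMatXY n s μ).PosDef)
    (x : Fin n → ℝ) (t : ℕ) :
    ∃ ν : Measure ℝ,
      (∀ k ≤ 2 * t, Integrable (fun y : ℝ => y ^ k) ν) ∧
      (hankelM t ν).PosDef ∧
      ∀ y : ℝ, CFXY n t μ x y = CFX n t (μ.map Prod.fst) x * CFY t ν y := by
  have hc := CFX_map_fst_pos (hPD t) x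
  set c := CFX n t (μ.map Prod.fst) x
  have hG : (c • ((fiberMat t x)ᵀ * (momMatXY n t μ)⁻¹ * fiberMat t x)).PosDef := by
    have := (hPD t).inv.conjTranspose_mul_mul_same (fiberMat_mulVec_injective x)
    rw [conjTranspose_eq_transpose_of_trivial] at this
    exact this.smul hc
  obtain ⟨H, hH, hpd, hinv⟩ := exists_hankel_inv_eq hG
  obtain ⟨ν, hInt, hν⟩ := hH.exists_measure hpd
  refine ⟨ν, fun k _ => hInt k, hν ▸ hpd, fun y => ?_⟩
  have hmon : fiberMat t x *ᵥ (fun i : Fin (t + 1) => y ^ (i : ℕ)) = monXY x y :=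
    funext fun γ => fiberMat_mulVec x _ γ
  rw [CFXY, CFY, hν, hinv, smul_mulVec, dotProduct_smul, ← mulVec_mulVec, hmon,
    ← mulVec_mulVec, dotProduct_mulVec _ (fiberMat t x)ᵀ, vecMul_transpose, hmon, smul_eq_mul,
    mul_inv, mul_inv_cancel_left₀ hc.ne']
end
end

section
/- Let Ω ⊂ X×ℝ ⊂ ℝⁿ×ℝ be compact with nonempty interior and set s_n(t) := C(n+t, n). Let μ_0 be a Borel measure on Ω with marginal φ_0 on X and conditional probability kernel μ̂_0(dy|x), and assume: (a) s_{n+1}(t)·Λ^{μ_0}_t(x,y) → W_0(x,y) uniformly on compact subsets of int(Ω), with W_0 continuous and positive; (b) s_n(t)·Λ^{φ_0}_t(x) → W_0'(x) uniformly on compact subsets of int(X), with W_0' continuous and positive; (c) the Feller-type property holds: x ↦ ∫ h(x,y) μ̂_0(dy|x) is continuous on X whenever h is continuous on Ω. Let μ be the measure on Ω with a continuous, positive density f with respect to μ_0, let φ be its marginal on X, let g(x) := ∫ f(x,y) μ̂_0(dy|x), and let (ν_{x,t})_t be any family of Borel measures on ℝ with positive definite moment matrices satisfying Λ^μ_t(x,y)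 = Λ^φ_t(x)·Λ^{ν_{x,t}}_t(y) for all y and t. Then for every (x,y) ∈ int(Ω): lim_{t→∞} t·Λ^{ν_{x,t}}_t(y) = (n+1)·(f(x,y)/g(x))·(W_0(x,y)/W_0'(x)). -/
open MeasureTheory Matrix Filter Topology ProbabilityTheory
open scoped ProbabilityTheory

noncomputable section

/-- `s_n(t) = C(n+t, n)`, the dimension of `ℝ[x]_t`. -/
def sdim (n t : ℕ) : ℕ := Nat.choose (n + t) n

section MatrixLemmas

variable {ι : Type*} [Fintype ι] [DecidableEq ι]

lemma Matrix.PosDef.inv_dotProduct_pos {A : Matrix ι ι ℝ} (hA : A.PosDef) {u : ι → ℝ}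
    (hu : u ≠ 0) : 0 < (u ⬝ᵥ A⁻¹ *ᵥ u)⁻¹ := by
  have := hA.inv.dotProduct_mulVec_pos hu
  rw [star_trivial] at this
  exact inv_pos.mpr this

lemma Matrix.PosDef.inv_mulVec_dotProduct_mulVec {A : Matrix ι ι ℝ} (hA : A.PosDef)
    (u c : ι → ℝ) : (A⁻¹ *ᵥ u) ⬝ᵥ A *ᵥ c = u ⬝ᵥ c := by
  have hs : (A⁻¹)ᵀ = A⁻¹ := hA.inv.isHermitian
  rw [← Matrix.vecMul_transpose, hs, ← Matrix.dotProduct_mulVec, Matrix.mulVec_mulVec,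
    Matrix.nonsing_inv_mul _ ((Matrix.isUnit_iff_isUnit_det _).mp hA.isUnit), Matrix.one_mulVec]

lemma Matrix.PosDef.mulVec_inv_mulVec {A : Matrix ι ι ℝ} (hA : A.PosDef) (u : ι → ℝ) :
    A *ᵥ (A⁻¹ *ᵥ u) = u := by
  rw [Matrix.mulVec_mulVec,
    Matrix.mul_nonsing_inv _ ((Matrix.isUnit_iff_isUnit_det _).mp hA.isUnit), Matrix.one_mulVec]

/-- The minimum of `cᵀ A c` subject to `cᵀ u = 1` is attained with value `(uᵀ A⁻¹ u)⁻¹`. -/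
lemma Matrix.PosDef.exists_dotProduct_mulVec_eq {A : Matrix ι ι ℝ} (hA : A.PosDef) {u : ι → ℝ}
    (hu : u ≠ 0) : ∃ c : ι → ℝ, c ⬝ᵥ u = 1 ∧ c ⬝ᵥ A *ᵥ c = (u ⬝ᵥ A⁻¹ *ᵥ u)⁻¹ := by
  have hpos := hA.inv_dotProduct_pos hu
  have hne : u ⬝ᵥ A⁻¹ *ᵥ u ≠ 0 := (inv_pos.mp hpos).ne'
  refine ⟨(u ⬝ᵥ A⁻¹ *ᵥ u)⁻¹ • A⁻¹ *ᵥ u, ?_, ?_⟩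
  · rw [smul_dotProduct, dotProduct_comm _ u, smul_eq_mul, inv_mul_cancel₀ hne]
  · rw [Matrix.mulVec_smul, smul_dotProduct, dotProduct_smul, hA.inv_mulVec_dotProduct_mulVec,
      smul_eq_mul, smul_eq_mul, inv_mul_cancel₀ hne, mul_one]

lemma Matrix.PosDef.inv_le_dotProduct_mulVec {A : Matrix ι ι ℝ} (hA : A.PosDef) {u c : ι → ℝ}
    (hu : u ≠ 0) (hc : c ⬝ᵥ u = 1) : (u ⬝ᵥ A⁻¹ *ᵥ u)⁻¹ ≤ c ⬝ᵥ A *ᵥ c := by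
  have hne : u ⬝ᵥ A⁻¹ *ᵥ u ≠ 0 := (inv_pos.mp (hA.inv_dotProduct_pos hu)).ne'
  set l := (u ⬝ᵥ A⁻¹ *ᵥ u)⁻¹ with hl
  have h := hA.posSemidef.dotProduct_mulVec_nonneg (c - l • A⁻¹ *ᵥ u)
  rw [star_trivial, Matrix.mulVec_sub, Matrix.mulVec_smul, hA.mulVec_inv_mulVec,
    sub_dotProduct, dotProduct_sub, dotProduct_sub, smul_dotProduct, smul_dotProduct,
    hA.inv_mulVec_dotProduct_mulVec, dotProduct_smul, dotProduct_smul, hc, dotProduct_comm u c, hc,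
    dotProduct_comm _ u] at h
  simp only [smul_eq_mul, mul_one] at h
  have : l * (u ⬝ᵥ A⁻¹ *ᵥ u) = 1 := inv_mul_cancel₀ hne
  rw [this] at h
  linarith

end MatrixLemmas

section Christoffel

/-- The matrix of `L²(μ)`-inner products of the functions `v · i`. -/
def gramMatrix {E ι : Type*} [MeasurableSpace E] (v : E → ι → ℝ) (μ : Measure E) :
    Matrix ι ι ℝ := fun i j => ∫ w, v w i * v w j ∂μ

/-- The Christoffel function of the span of the functions `v · i` in `L²(μ)`. -/
def christoffel {E ι : Type*} [MeasurableSpace E] [Fintype ι] [DecidableEq ι] (v : E → ι → ℝ)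
    (μ : Measure E) (z : E) : ℝ := (v z ⬝ᵥ (gramMatrix v μ)⁻¹ *ᵥ v z)⁻¹

/-- The space of functions spanned by the `t`-th level of a system of functions. -/
def levelSpan {E : Type*} {ι : ℕ → Type*} (v : ∀ t, E → ι t → ℝ) (t : ℕ) :
    Submodule ℝ (E → ℝ) := Submodule.span ℝ (Set.range fun i w => v t w i)

/-- The properties of the system of monomials, graded by degree, used to localize
Christoffel functions. -/
structure IsMonomialSystem {E : Type*} [TopologicalSpace E] {ι : ℕ → Type*}
    (v : ∀ t, E → ι t → ℝ) : Prop where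
  cont : ∀ t i, Continuous fun w => v t w i
  one_mem : ∀ t, (1 : E → ℝ) ∈ levelSpan v t
  mul_mem : ∀ {s t p q}, p ∈ levelSpan v s → q ∈ levelSpan v t → p * q ∈ levelSpan v (s + t)
  exists_dist : ∀ z, ∃ N ∈ levelSpan v 2, N z = 0 ∧ ∀ w ≠ z, 0 < N w

namespace IsMonomialSystem

variable {E : Type*} [TopologicalSpace E] {ι : ℕ → Type*} {v : ∀ t, E → ι t → ℝ}

lemma continuous_of_mem (hv : IsMonomialSystem v) {t : ℕ} {p : E → ℝ} (hp : p ∈ levelSpan v t) :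
    Continuous p := by
  induction hp using Submodule.span_induction with
  | mem x hx => obtain ⟨i, rfl⟩ := hx; exact hv.cont t i
  | zero => exact continuous_zero
  | add x y _ _ hx hy => exact hx.add hy
  | smul a x _ hx => exact continuous_const.smul hx

lemma ne_zero (hv : IsMonomialSystem v) (t : ℕ) (z : E) : v t z ≠ 0 := by
  intro h
  have key : ∀ p ∈ levelSpan v t, p z = 0 := by
    intro p hp
    induction hp using Submodule.span_induction with
    | mem x hx => obtain ⟨i, rfl⟩ := hx; exact congrFun h i
    | zero => rfl
    | add x y _ _ hx hy => simp [hx, hy]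
    | smul a x _ hx => simp [hx]
  exact one_ne_zero (key 1 (hv.one_mem t))

lemma pow_mem (hv : IsMonomialSystem v) {q : E → ℝ} (hq : q ∈ levelSpan v 2) (m : ℕ) :
    q ^ m ∈ levelSpan v (2 * m) := by
  induction m with
  | zero => simpa using hv.one_mem 0
  | succ k ih => rw [pow_succ]; exact hv.mul_mem ih hq

/-- A function of level two that peaks at `z` relative to a compact set. -/
lemma exists_peak (hv : IsMonomialSystem v) {K U : Set E} (hK : IsCompact K) {z : E}
    (hU : IsOpen U) (hz : z ∈ U) : ∃ q ∈ levelSpan v 2, q z = 1 ∧ ∃ ρ : ℝ, 0 ≤ ρ ∧ ρ < 1 ∧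
      ∀ w ∈ K, |q w| ≤ 1 ∧ (w ∉ U → |q w| ≤ ρ) := by
  obtain ⟨N, hN, hNz, hNpos⟩ := hv.exists_dist z
  have hNc := hv.continuous_of_mem hN
  have hN0 : ∀ w, 0 ≤ N w := fun w => by
    by_cases h : w = z
    · rw [h, hNz]
    · exact (hNpos w h).le
  obtain ⟨D₀, hD₀⟩ := hK.bddAbove_image hNc.continuousOn
  set D := max D₀ 1 with hD
  have hDpos : 0 < D := lt_of_lt_of_le one_pos (le_max_right _ _)
  have hND : ∀ w ∈ K, N w / D ≤ 1 := fun w hw => by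
    rw [div_le_one hDpos]
    exact (hD₀ ⟨w, hw, rfl⟩).trans (le_max_left _ _)
  obtain ⟨η, hη, hηN⟩ : ∃ η : ℝ, 0 < η ∧ ∀ w ∈ K, w ∉ U → η ≤ N w := by
    rcases (K \ U).eq_empty_or_nonempty with he | hne
    · refine ⟨1, one_pos, fun w hw hwU => ?_⟩
      have : w ∈ K \ U := ⟨hw, hwU⟩
      simp [he] at this
    · obtain ⟨w₀, hw₀, hmin⟩ := (hK.diff hU).exists_isMinOn hne hNc.continuousOn
      exact ⟨N w₀, hNpos _ fun h => hw₀.2 (h ▸ hz), fun w hw hwU => hmin ⟨hw, hwU⟩⟩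
  refine ⟨1 - D⁻¹ • N, sub_mem (hv.one_mem 2) (Submodule.smul_mem _ _ hN), by simp [hNz],
    max 0 (1 - η / D), le_max_left _ _, max_lt one_pos (by linarith [div_pos hη hDpos]),
    fun w hw => ?_⟩
  have h1 := hND w hw
  have h0 : 0 ≤ N w / D := div_nonneg (hN0 w) hDpos.le
  have hval : (1 - D⁻¹ • N) w = 1 - N w / D := by simp [div_eq_inv_mul]
  rw [hval, abs_of_nonneg (by linarith)]
  refine ⟨by linarith, fun hwU => le_max_of_le_right ?_⟩
  have := div_le_div_of_nonneg_right (hηN w hw hwU) hDpos.le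
  linarith

variable [MeasurableSpace E]

lemma christoffel_pos [∀ t, Fintype (ι t)] [∀ t, DecidableEq (ι t)]
    (hv : IsMonomialSystem v) {μ : Measure E} {t : ℕ}
    (hPD : (gramMatrix (v t) μ).PosDef) (z : E) : 0 < christoffel (v t) μ z :=
  hPD.inv_dotProduct_pos (hv.ne_zero t z)

variable [BorelSpace E] [T2Space E]

lemma integrable_of_continuous {μ : Measure E} [IsFiniteMeasure μ] {K : Set E} (hK : IsCompact K)
    (hμK : μ Kᶜ = 0) {p : E → ℝ} (hp : Continuous p) : Integrable p μ := by
  have : μ.restrict K = μ := Measure.restrict_eq_self_of_ae_mem (mem_ae_iff.mpr hμK)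
  rw [← this]
  exact hp.continuousOn.integrableOn_compact hK

variable [∀ t, Fintype (ι t)]

lemma dotProduct_gramMatrix (hv : IsMonomialSystem v) {μ : Measure E} [IsFiniteMeasure μ]
    {K : Set E} (hK : IsCompact K) (hμK : μ Kᶜ = 0) (t : ℕ) (c : ι t → ℝ) :
    c ⬝ᵥ gramMatrix (v t) μ *ᵥ c = ∫ w, (c ⬝ᵥ v t w) ^ 2 ∂μ := by
  have hint : ∀ i j, Integrable (fun w => c i * (v t w i * v t w j * c j)) μ := fun i j =>
    integrable_of_continuous hK hμK (continuous_const.mul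
      (((hv.cont t i).mul (hv.cont t j)).mul continuous_const))
  have : ∀ w, (c ⬝ᵥ v t w) ^ 2 = ∑ i, ∑ j, c i * (v t w i * v t w j * c j) := fun w => by
    rw [sq, dotProduct, Finset.sum_mul_sum]
    exact Finset.sum_congr rfl fun i _ => Finset.sum_congr rfl fun j _ => by ring
  simp_rw [this]
  rw [integral_finsetSum _ fun i _ => integrable_finsetSum _ fun j _ => hint i j]
  refine Finset.sum_congr rfl fun i _ => ?_
  rw [integral_finsetSum _ fun j _ => hint i j, mulVec, dotProduct, Finset.mul_sum]
  refine Finset.sum_congr rfl fun j _ => ?_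
  rw [integral_const_mul, integral_mul_const]
  rfl

variable [∀ t, DecidableEq (ι t)]

lemma exists_integral_eq_christoffel (hv : IsMonomialSystem v) {μ : Measure E}
    [IsFiniteMeasure μ] {K : Set E} (hK : IsCompact K) (hμK : μ Kᶜ = 0) {t : ℕ}
    (hPD : (gramMatrix (v t) μ).PosDef) (z : E) :
    ∃ p ∈ levelSpan v t, p z = 1 ∧ ∫ w, p w ^ 2 ∂μ = christoffel (v t) μ z := by
  obtain ⟨c, hc, hc'⟩ := hPD.exists_dotProduct_mulVec_eq (hv.ne_zero t z)
  refine ⟨fun w => c ⬝ᵥ v t w, ?_, hc, ?_⟩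
  · refine (Submodule.mem_span_range_iff_exists_fun ℝ).mpr ⟨c, ?_⟩
    ext w
    simp [dotProduct]
  · rw [← hv.dotProduct_gramMatrix hK hμK, hc', christoffel]

lemma christoffel_le_integral (hv : IsMonomialSystem v) {μ : Measure E}
    [IsFiniteMeasure μ] {K : Set E} (hK : IsCompact K) (hμK : μ Kᶜ = 0) {t : ℕ}
    (hPD : (gramMatrix (v t) μ).PosDef) {z : E} {p : E → ℝ} (hp : p ∈ levelSpan v t)
    (hpz : p z = 1) : christoffel (v t) μ z ≤ ∫ w, p w ^ 2 ∂μ := by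
  obtain ⟨c, rfl⟩ := (Submodule.mem_span_range_iff_exists_fun ℝ).mp hp
  have h : ∀ w, (∑ i, c i • fun w => v t w i) w = c ⬝ᵥ v t w := fun w => by simp [dotProduct]
  simp_rw [h] at hpz ⊢
  rw [← hv.dotProduct_gramMatrix hK hμK]
  exact hPD.inv_le_dotProduct_mulVec (hv.ne_zero t z) hpz

/-- Localization: a comparison of measures near `z` yields a comparison of Christoffel functions
at `z`, up to an exponentially small error and a shift of the degree. -/
lemma exists_christoffel_le (hv : IsMonomialSystem v) {μ μ₀ : Measure E} [IsFiniteMeasure μ]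
    [IsFiniteMeasure μ₀] {K U : Set E} (hK : IsCompact K) (hμK : μ Kᶜ = 0) (hμ₀K : μ₀ Kᶜ = 0)
    (hPD : ∀ t, (gramMatrix (v t) μ).PosDef) (hPD₀ : ∀ t, (gramMatrix (v t) μ₀).PosDef)
    {z : E} (hU : IsOpen U) (hz : z ∈ U) {L M : ℝ} (hL : 0 ≤ L) (hM : 0 ≤ M)
    (hLU : μ.restrict U ≤ ENNReal.ofReal L • μ₀) (hMμ : μ ≤ ENNReal.ofReal M • μ₀) :
    ∃ ρ : ℝ, 0 ≤ ρ ∧ ρ < 1 ∧ ∀ T m : ℕ,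
      christoffel (v (T + 2 * m)) μ z ≤ (L + M * ρ ^ m) * christoffel (v T) μ₀ z := by
  obtain ⟨q, hq, hqz, ρ, hρ0, hρ1, hqK⟩ := hv.exists_peak hK hU hz
  refine ⟨ρ ^ 2, sq_nonneg _, pow_lt_one₀ hρ0 hρ1 two_ne_zero, fun T m => ?_⟩
  obtain ⟨p, hp, hpz, hpI⟩ := hv.exists_integral_eq_christoffel hK hμ₀K (hPD₀ T) z
  have hpq := hv.mul_mem hp (hv.pow_mem hq m)
  have hpc := hv.continuous_of_mem hp
  have hpqc := hv.continuous_of_mem hpq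
  have hKm : ∀ᵐ w ∂μ, w ∈ K := mem_ae_iff.mpr hμK
  have hip : Integrable (fun w => p w ^ 2) μ := integrable_of_continuous hK hμK (hpc.pow 2)
  have hip₀ : Integrable (fun w => p w ^ 2) μ₀ := integrable_of_continuous hK hμ₀K (hpc.pow 2)
  have hipq : Integrable (fun w => (p * q ^ m) w ^ 2) μ :=
    integrable_of_continuous hK hμK (hpqc.pow 2)
  have hfac : ∀ w, (p * q ^ m) w ^ 2 = p w ^ 2 * (|q w| ^ m) ^ 2 := fun w => by
    simp only [Pi.mul_apply, Pi.pow_apply, mul_pow]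
    rw [← pow_mul, ← pow_mul, mul_comm m 2, pow_mul, pow_mul, sq_abs]
  have hcomp : ∀ {ν : Measure E} {C : ℝ}, 0 ≤ C → ν ≤ ENNReal.ofReal C • μ₀ →
      ∫ w, p w ^ 2 ∂ν ≤ C * christoffel (v T) μ₀ z := fun {ν C} hC hν => by
    have := integral_mono_measure hν (Eventually.of_forall fun w => sq_nonneg (p w))
      (hip₀.smul_measure ENNReal.ofReal_ne_top)
    rwa [integral_smul_measure, ENNReal.toReal_ofReal hC, hpI, smul_eq_mul] at this
  have hin : ∫ w in U, (p * q ^ m) w ^ 2 ∂μ ≤ L * christoffel (v T) μ₀ z := by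
    refine le_trans (integral_mono_ae hipq.restrict hip.restrict ?_) (hcomp hL hLU)
    filter_upwards [ae_restrict_of_ae hKm] with w hw
    rw [hfac]
    exact mul_le_of_le_one_right (sq_nonneg _)
      (pow_le_one₀ (by positivity) (pow_le_one₀ (abs_nonneg _) (hqK w hw).1))
  have hout : ∫ w in Uᶜ, (p * q ^ m) w ^ 2 ∂μ ≤
      (ρ ^ 2) ^ m * (M * christoffel (v T) μ₀ z) := by
    have h1 : ∫ w in Uᶜ, (p * q ^ m) w ^ 2 ∂μ ≤ ∫ w in Uᶜ, (ρ ^ 2) ^ m * p w ^ 2 ∂μ := by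
      refine integral_mono_ae hipq.restrict (hip.restrict.const_mul _) ?_
      filter_upwards [ae_restrict_of_ae hKm, ae_restrict_mem hU.measurableSet.compl] with w hw hwU
      rw [hfac, mul_comm, ← pow_mul, mul_comm m 2, pow_mul]
      gcongr
      exact (hqK w hw).2 hwU
    rw [integral_const_mul] at h1
    refine h1.trans (mul_le_mul_of_nonneg_left ?_ (by positivity))
    exact hcomp hM (Measure.restrict_le_self.trans hMμ)
  calc christoffel (v (T + 2 * m)) μ z ≤ ∫ w, (p * q ^ m) w ^ 2 ∂μ :=
        hv.christoffel_le_integral hK hμK (hPD _) hpq (by simp [hpz, hqz])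
    _ = ∫ w in U, (p * q ^ m) w ^ 2 ∂μ + ∫ w in Uᶜ, (p * q ^ m) w ^ 2 ∂μ :=
        (integral_add_compl hU.measurableSet hipq).symm
    _ ≤ L * christoffel (v T) μ₀ z + (ρ ^ 2) ^ m * (M * christoffel (v T) μ₀ z) :=
        add_le_add hin hout
    _ = (L + M * (ρ ^ 2) ^ m) * christoffel (v T) μ₀ z := by ring

end IsMonomialSystem

end Christoffel

section Asymptotics

lemma tendsto_atTop_of_div_tendsto_one {u : ℕ → ℕ}
    (hu : Tendsto (fun t => (u t : ℝ) / t) atTop (𝓝 1)) : Tendsto u atTop atTop := by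
  rw [← tendsto_natCast_atTop_iff (R := ℝ)]
  refine (hu.pos_mul_atTop one_pos tendsto_natCast_atTop_atTop).congr' ?_
  filter_upwards [eventually_gt_atTop 0] with t ht
  have : (t : ℝ) ≠ 0 := by positivity
  field_simp

lemma sqrt_div_tendsto_zero : Tendsto (fun t : ℕ => (Nat.sqrt t : ℝ) / t) atTop (𝓝 0) := by
  have h : Tendsto (fun t : ℕ => (√(t : ℝ))⁻¹) atTop (𝓝 0) :=
    tendsto_inv_atTop_zero.comp (Real.tendsto_sqrt_atTop.comp tendsto_natCast_atTop_atTop)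
  refine squeeze_zero (fun t => by positivity) (fun t => ?_) h
  calc (Nat.sqrt t : ℝ) / t ≤ √(t : ℝ) / t := by gcongr; exact Real.nat_sqrt_le_real_sqrt
    _ = (√(t : ℝ))⁻¹ := Real.sqrt_div_self

lemma add_two_mul_sqrt_div_tendsto :
    Tendsto (fun t : ℕ => ((t + 2 * Nat.sqrt t : ℕ) : ℝ) / t) atTop (𝓝 1) := by
  have h := (sqrt_div_tendsto_zero.const_mul 2).const_add 1
  rw [mul_zero, add_zero] at h
  refine h.congr' ?_
  filter_upwards [eventually_gt_atTop 0] with t ht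
  have : (t : ℝ) ≠ 0 := by positivity
  push_cast
  field_simp

lemma two_mul_sqrt_le {t : ℕ} (ht : 4 ≤ t) : 2 * Nat.sqrt t ≤ t :=
  (Nat.mul_le_mul_right _ (Nat.le_sqrt.mpr ht)).trans (Nat.sqrt_le t)

lemma sub_two_mul_sqrt_div_tendsto :
    Tendsto (fun t : ℕ => ((t - 2 * Nat.sqrt t : ℕ) : ℝ) / t) atTop (𝓝 1) := by
  have h := (sqrt_div_tendsto_zero.const_mul 2).const_sub 1
  rw [mul_zero, sub_zero] at h
  refine h.congr' ?_
  filter_upwards [eventually_ge_atTop 4] with t ht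
  have : (t : ℝ) ≠ 0 := by positivity
  rw [Nat.cast_sub (two_mul_sqrt_le ht)]
  push_cast
  field_simp

lemma sqrt_tendsto_atTop : Tendsto Nat.sqrt atTop atTop :=
  tendsto_atTop.mpr fun b => by
    filter_upwards [eventually_ge_atTop (b * b)] with t ht
    exact Nat.le_sqrt.mpr ht

lemma add_mul_pow_sqrt_tendsto (L M : ℝ) {ρ : ℝ} (hρ0 : 0 ≤ ρ) (hρ1 : ρ < 1) :
    Tendsto (fun t : ℕ => L + M * ρ ^ Nat.sqrt t) atTop (𝓝 L) := by
  simpa using (((tendsto_pow_atTop_nhds_zero_of_lt_one hρ0 hρ1).comp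
    sqrt_tendsto_atTop).const_mul M).const_add L

lemma sdim_pos (n t : ℕ) : (0 : ℝ) < sdim n t := by
  exact_mod_cast Nat.choose_pos (Nat.le_add_right n t)

lemma sdim_succ (n t : ℕ) : (sdim (n + 1) t : ℝ) = sdim n t * ((n + 1 + t) / (n + 1)) := by
  have h := Nat.add_one_mul_choose_eq (n + t) n
  have h' : ((n : ℝ) + t + 1) * sdim n t = sdim (n + 1) t * (n + 1) := by
    rw [sdim, sdim, Nat.add_right_comm n 1 t]
    exact_mod_cast h
  field_simp
  linarith

/-- The dimension `s_n` is regularly varying. -/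
lemma sdim_comp_div_tendsto (n : ℕ) {u : ℕ → ℕ}
    (hu : Tendsto (fun t => (u t : ℝ) / t) atTop (𝓝 1)) :
    Tendsto (fun t => (sdim n (u t) : ℝ) / sdim n t) atTop (𝓝 1) := by
  induction n with
  | zero => simp [sdim]
  | succ n ih =>
    have hc : Tendsto (fun t : ℕ => ((n : ℝ) + 1) / t) atTop (𝓝 0) :=
      tendsto_const_div_atTop_nhds_zero_nat _
    have h := ih.mul ((hc.add hu).div (hc.add_const 1) (by norm_num))
    norm_num at h
    refine h.congr' ?_
    filter_upwards [eventually_gt_atTop 0] with t ht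
    have := (sdim_pos n t).ne'
    have : (t : ℝ) ≠ 0 := by positivity
    have : (n : ℝ) + 1 + t ≠ 0 := by positivity
    simp only [sdim_succ]
    field_simp

variable {n : ℕ} {A B : ℕ → ℝ} {L M ρ W l : ℝ}

lemma eventually_sdim_mul_lt (hρ0 : 0 ≤ ρ) (hρ1 : ρ < 1)
    (H : ∀ T m, B (T + 2 * m) ≤ (L + M * ρ ^ m) * A T)
    (hA : Tendsto (fun t => (sdim n t : ℝ) * A t) atTop (𝓝 W)) (hl : L * W < l) :
    ∀ᶠ t in atTop, (sdim n t : ℝ) * B t < l := by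
  have hu := sub_two_mul_sqrt_div_tendsto
  have h := ((sdim_comp_div_tendsto n hu).inv₀ one_ne_zero).mul
    ((add_mul_pow_sqrt_tendsto L M hρ0 hρ1).mul (hA.comp (tendsto_atTop_of_div_tendsto_one hu)))
  rw [inv_one, one_mul] at h
  filter_upwards [h.eventually_lt_const hl, eventually_ge_atTop 4] with t ht h4
  refine lt_of_le_of_lt ?_ ht
  have hB := H (t - 2 * Nat.sqrt t) (Nat.sqrt t)
  rw [Nat.sub_add_cancel (two_mul_sqrt_le h4)] at hB
  refine (mul_le_mul_of_nonneg_left hB (sdim_pos n t).le).trans_eq ?_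
  have := (sdim_pos n (t - 2 * Nat.sqrt t)).ne'
  simp only [Function.comp]
  field_simp

lemma eventually_lt_sdim_mul (hρ0 : 0 ≤ ρ) (hρ1 : ρ < 1) (hL : 0 < L) (hM : 0 ≤ M)
    (H : ∀ T m, B (T + 2 * m) ≤ (L + M * ρ ^ m) * A T)
    (hB : Tendsto (fun t => (sdim n t : ℝ) * B t) atTop (𝓝 W)) (hl : l < W / L) :
    ∀ᶠ t in atTop, l < (sdim n t : ℝ) * A t := by
  have hu := add_two_mul_sqrt_div_tendsto
  have h := ((sdim_comp_div_tendsto n hu).inv₀ one_ne_zero).mul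
    ((hB.comp (tendsto_atTop_of_div_tendsto_one hu)).div
      (add_mul_pow_sqrt_tendsto L M hρ0 hρ1) hL.ne')
  rw [inv_one, one_mul] at h
  filter_upwards [h.eventually_const_lt hl] with t ht
  refine ht.trans_le ?_
  have hc : 0 < L + M * ρ ^ Nat.sqrt t := by positivity
  have hs := sdim_pos n (t + 2 * Nat.sqrt t)
  have hs' := sdim_pos n t
  have := (div_le_iff₀' hc).mpr (H t (Nat.sqrt t))
  calc _ = (sdim n t : ℝ) * (B (t + 2 * Nat.sqrt t) / (L + M * ρ ^ Nat.sqrt t)) := by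
        simp only [Function.comp, Pi.div_apply]
        field_simp
    _ ≤ _ := mul_le_mul_of_nonneg_left this hs'.le

end Asymptotics

namespace IsMonomialSystem

variable {E : Type*} [TopologicalSpace E] [MeasurableSpace E] [BorelSpace E] [T2Space E]
  {ι : ℕ → Type*} [∀ t, Fintype (ι t)] [∀ t, DecidableEq (ι t)] {v : ∀ t, E → ι t → ℝ}

/-- If the scaled Christoffel functions have a positive limit at `z`, then `z` belongs to the
support of the measure. -/
lemma measure_ne_zero (hv : IsMonomialSystem v) {μ : Measure E} [IsFiniteMeasure μ] {K U : Set E}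
    (hK : IsCompact K) (hμK : μ Kᶜ = 0) (hPD : ∀ t, (gramMatrix (v t) μ).PosDef) {n : ℕ}
    {z : E} {W : ℝ} (hW : 0 < W)
    (hlim : Tendsto (fun t => (sdim n t : ℝ) * christoffel (v t) μ z) atTop (𝓝 W))
    (hU : IsOpen U) (hz : z ∈ U) : μ U ≠ 0 := by
  intro h0
  obtain ⟨ρ, hρ0, hρ1, H⟩ := hv.exists_christoffel_le hK hμK hμK hPD hPD hU hz le_rfl zero_le_one
    (by simp [Measure.restrict_eq_zero.mpr h0]) (by simp)
  have h1 := eventually_sdim_mul_lt (L := 0) (M := 1) (l := W / 2)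
    (B := fun t => christoffel (v t) μ z) hρ0 hρ1 H hlim (by rw [zero_mul]; exact half_pos hW)
  have h2 := hlim.eventually_const_lt (half_lt_self hW)
  obtain ⟨t, h1, h2⟩ := (h1.and h2).exists
  exact lt_asymm h1 h2

/-- Multiplying a measure by a density multiplies the limit of the scaled Christoffel functions
by the value of the density. -/
theorem tendsto_sdim_mul_christoffel_withDensity (hv : IsMonomialSystem v) {μ₀ μ : Measure E}
    [IsFiniteMeasure μ₀] {K : Set E} (hK : IsCompact K) (hμ₀K : μ₀ Kᶜ = 0) {h : E → ℝ}
    (hμ : μ = μ₀.withDensity fun w => ENNReal.ofReal (h w)) {a b : ℝ} (ha : 0 < a)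
    (hah : ∀ᵐ w ∂μ₀, a ≤ h w) (hhb : ∀ᵐ w ∂μ₀, h w ≤ b)
    (hPD₀ : ∀ t, (gramMatrix (v t) μ₀).PosDef) (hPD : ∀ t, (gramMatrix (v t) μ).PosDef)
    {n : ℕ} {z : E} (hhz : ContinuousAt h z) (hz : 0 < h z) {W : ℝ} (hW : 0 < W)
    (hlim : Tendsto (fun t => (sdim n t : ℝ) * christoffel (v t) μ₀ z) atTop (𝓝 W)) :
    Tendsto (fun t => (sdim n t : ℝ) * christoffel (v t) μ z) atTop (𝓝 (h z * W)) := by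
  have upper : ∀ {S : Set E} {c : ℝ}, MeasurableSet S → (∀ᵐ w ∂μ₀.restrict S, h w ≤ c) →
      μ.restrict S ≤ ENNReal.ofReal c • μ₀ := fun {S c} hS hc => by
    refine Measure.le_iff.mpr fun s hs => ?_
    rw [Measure.restrict_apply hs, hμ, withDensity_apply _ (hs.inter hS)]
    calc ∫⁻ w in s ∩ S, ENNReal.ofReal (h w) ∂μ₀ ≤ ∫⁻ _ in s ∩ S, ENNReal.ofReal c ∂μ₀ := by
          refine lintegral_mono_ae ?_
          filter_upwards [ae_restrict_of_ae_restrict_of_subset Set.inter_subset_right hc] with w hw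
          exact ENNReal.ofReal_le_ofReal hw
      _ ≤ (ENNReal.ofReal c • μ₀) s := by
          rw [setLIntegral_const, Measure.smul_apply, smul_eq_mul]
          gcongr
          exact Set.inter_subset_left
  have lower : ∀ {S : Set E} {c : ℝ}, 0 < c → MeasurableSet S →
      (∀ᵐ w ∂μ₀.restrict S, c ≤ h w) → μ₀.restrict S ≤ ENNReal.ofReal c⁻¹ • μ :=
      fun {S c} hc0 hS hc => by
    refine Measure.le_iff.mpr fun s hs => ?_
    rw [Measure.restrict_apply hs, Measure.smul_apply, smul_eq_mul, ENNReal.ofReal_inv_of_pos hc0,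
      ← ENNReal.div_eq_inv_mul, ENNReal.le_div_iff_mul_le (by simp [hc0]) (by simp), mul_comm]
    calc ENNReal.ofReal c * μ₀ (s ∩ S) = ∫⁻ _ in s ∩ S, ENNReal.ofReal c ∂μ₀ := by
          rw [setLIntegral_const]
      _ ≤ ∫⁻ w in s ∩ S, ENNReal.ofReal (h w) ∂μ₀ := by
          refine lintegral_mono_ae ?_
          filter_upwards [ae_restrict_of_ae_restrict_of_subset Set.inter_subset_right hc] with w hw
          exact ENNReal.ofReal_le_ofReal hw
      _ = μ (s ∩ S) := by rw [hμ, withDensity_apply _ (hs.inter hS)]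
      _ ≤ μ s := measure_mono Set.inter_subset_left
  have hM : μ ≤ ENNReal.ofReal (max b 0) • μ₀ := by
    have := upper (c := max b 0) MeasurableSet.univ
      (by rw [Measure.restrict_univ]; exact hhb.mono fun w hw => le_max_of_le_left hw)
    rwa [Measure.restrict_univ] at this
  have hM₀ : μ₀ ≤ ENNReal.ofReal a⁻¹ • μ := by
    have := lower ha MeasurableSet.univ (by rwa [Measure.restrict_univ])
    rwa [Measure.restrict_univ] at this
  have hfin : IsFiniteMeasure μ := ⟨(hM _).trans_lt
    (ENNReal.mul_lt_top ENNReal.ofReal_lt_top (measure_lt_top μ₀ _))⟩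
  have hμK : μ Kᶜ = 0 := by
    rw [hμ]
    exact withDensity_absolutelyContinuous _ _ hμ₀K
  refine tendsto_order.mpr ⟨fun l hl => ?_, fun l hl => ?_⟩
  · obtain ⟨c, hc, hch⟩ : ∃ c, max 0 (l / W) < c ∧ c < h z :=
      exists_between (max_lt hz ((div_lt_iff₀ hW).mpr hl))
    have hc0 : 0 < c := (le_max_left _ _).trans_lt hc
    obtain ⟨U, hUh, hU, hzU⟩ := eventually_nhds_iff.mp (hhz.eventually_const_lt hch)
    obtain ⟨ρ, hρ0, hρ1, H⟩ := hv.exists_christoffel_le hK hμ₀K hμK hPD₀ hPD hU hzU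
      (inv_pos.mpr hc0).le (inv_pos.mpr ha).le
      (lower hc0 hU.measurableSet
        ((ae_restrict_mem hU.measurableSet).mono fun w hw => (hUh w hw).le)) hM₀
    refine eventually_lt_sdim_mul hρ0 hρ1 (inv_pos.mpr hc0) (inv_pos.mpr ha).le H hlim ?_
    rw [div_inv_eq_mul, mul_comm, ← div_lt_iff₀ hW]
    exact (le_max_right _ _).trans_lt hc
  · obtain ⟨c, hch, hc⟩ : ∃ c, h z < c ∧ c < l / W := exists_between ((lt_div_iff₀ hW).mpr hl)
    obtain ⟨U, hUh, hU, hzU⟩ := eventually_nhds_iff.mp (hhz.eventually_lt_const hch)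
    obtain ⟨ρ, hρ0, hρ1, H⟩ := hv.exists_christoffel_le hK hμK hμ₀K hPD hPD₀ hU hzU
      (hz.trans hch).le (le_max_right b 0)
      (upper hU.measurableSet
        ((ae_restrict_mem hU.measurableSet).mono fun w hw => (hUh w hw).le)) hM
    exact eventually_sdim_mul_lt hρ0 hρ1 H hlim ((lt_div_iff₀ hW).mp hc)

end IsMonomialSystem

section Monomials

lemma prod_pow_mem_levelSpan {n t : ℕ} {a : Fin n → ℕ} (ha : ∑ i, a i ≤ t) :
    (fun x : Fin n → ℝ => ∏ i, x i ^ a i) ∈ levelSpan (fun t => @mon n t) t :=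
  Submodule.subset_span ⟨⟨fun i => ⟨a i, Nat.lt_succ_of_le
    ((Finset.single_le_sum (fun j _ => Nat.zero_le (a j)) (Finset.mem_univ i)).trans ha)⟩, ha⟩, rfl⟩

lemma prod_pow_mul_pow_mem_levelSpan {n t : ℕ} {a : Fin n → ℕ} {k : ℕ}
    (ha : ∑ i, a i + k ≤ t) :
    (fun z : (Fin n → ℝ) × ℝ => (∏ i, z.1 i ^ a i) * z.2 ^ k) ∈
      levelSpan (fun t (z : (Fin n → ℝ) × ℝ) => @monXY n t z.1 z.2) t :=
  Submodule.subset_span ⟨⟨(fun i => ⟨a i, Nat.lt_succ_of_le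
    ((Finset.single_le_sum (fun j _ => Nat.zero_le (a j)) (Finset.mem_univ i)).trans
      ((Nat.le_add_right _ k).trans ha))⟩,
    ⟨k, Nat.lt_succ_of_le ((Nat.le_add_left k _).trans ha)⟩), ha⟩, rfl⟩

lemma levelSpan_mul_mem {E : Type*} {ι : ℕ → Type*} {v : ∀ t, E → ι t → ℝ} {s t : ℕ}
    (h : ∀ i j, (fun w => v s w i * v t w j) ∈ levelSpan v (s + t)) {p q : E → ℝ}
    (hp : p ∈ levelSpan v s) (hq : q ∈ levelSpan v t) : p * q ∈ levelSpan v (s + t) := by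
  have hle : levelSpan v s * levelSpan v t ≤ levelSpan v (s + t) := by
    rw [levelSpan, levelSpan, Submodule.span_mul_span, Submodule.span_le]
    rintro _ ⟨_, ⟨i, rfl⟩, _, ⟨j, rfl⟩, rfl⟩
    exact h i j
  exact hle (Submodule.mul_mem_mul hp hq)

lemma mul_mem_levelSpan_mon {n s t : ℕ} {p q : (Fin n → ℝ) → ℝ}
    (hp : p ∈ levelSpan (fun t => @mon n t) s) (hq : q ∈ levelSpan (fun t => @mon n t) t) :
    p * q ∈ levelSpan (fun t => @mon n t) (s + t) := by
  refine levelSpan_mul_mem (fun i j => ?_) hp hq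
  simp only [mon, ← Finset.prod_mul_distrib, ← pow_add]
  refine prod_pow_mem_levelSpan ?_
  rw [Finset.sum_add_distrib]
  exact add_le_add i.2 j.2

lemma isMonomialSystem_mon (n : ℕ) : IsMonomialSystem fun t => @mon n t := by
  have one : ∀ t, (1 : (Fin n → ℝ) → ℝ) ∈ levelSpan (fun t => @mon n t) t := fun t => by
    convert prod_pow_mem_levelSpan (n := n) (t := t) (a := 0) (by simp)
    simp
  refine ⟨fun t i => by unfold mon; fun_prop, one, mul_mem_levelSpan_mon, fun z => ?_⟩
  have const : ∀ c : ℝ, (fun _ : Fin n → ℝ => c) ∈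
      levelSpan (fun t => @mon n t) 1 := fun c => by
    convert Submodule.smul_mem _ c (one 1)
    simp
  have coord : ∀ i, (fun x : Fin n → ℝ => x i - z i) ∈ levelSpan (fun t => @mon n t) 1 := by
    intro i
    refine sub_mem ?_ ?_
    · have := prod_pow_mem_levelSpan (n := n) (t := 1) (a := Pi.single i 1) (by simp)
      simpa [Pi.single_apply, pow_ite] using this
    · exact const _
  have sq_mem : ∀ i, (fun x : Fin n → ℝ => x i - z i) * (fun x => x i - z i) ∈
      levelSpan (fun t => @mon n t) 2 := fun i => by
    have := mul_mem_levelSpan_mon (coord i) (coord i)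
    rwa [one_add_one_eq_two] at this
  refine ⟨∑ i, (fun x : Fin n → ℝ => x i - z i) * (fun x => x i - z i),
    sum_mem fun i _ => sq_mem i, by simp, fun w hw => ?_⟩
  obtain ⟨i, hi⟩ := Function.ne_iff.mp hw
  simp only [Finset.sum_apply, Pi.mul_apply]
  exact Finset.sum_pos' (fun j _ => mul_self_nonneg _)
    ⟨i, Finset.mem_univ i, mul_self_pos.mpr (sub_ne_zero.mpr hi)⟩

lemma mul_mem_levelSpan_monXY {n s t : ℕ} {p q : (Fin n → ℝ) × ℝ → ℝ}
    (hp : p ∈ levelSpan (fun t (z : (Fin n → ℝ) × ℝ) => @monXY n t z.1 z.2) s)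
    (hq : q ∈ levelSpan (fun t (z : (Fin n → ℝ) × ℝ) => @monXY n t z.1 z.2) t) :
    p * q ∈ levelSpan (fun t (z : (Fin n → ℝ) × ℝ) => @monXY n t z.1 z.2) (s + t) := by
  refine levelSpan_mul_mem (fun i j => ?_) hp hq
  simp only [monXY, mul_mul_mul_comm _ (_ ^ _), ← Finset.prod_mul_distrib, ← pow_add]
  refine prod_pow_mul_pow_mem_levelSpan ?_
  rw [Finset.sum_add_distrib, add_add_add_comm]
  exact add_le_add i.2 j.2

lemma isMonomialSystem_monXY (n : ℕ) :
    IsMonomialSystem fun t (z : (Fin n → ℝ) × ℝ) => @monXY n t z.1 z.2 := by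
  have one : ∀ t, (1 : (Fin n → ℝ) × ℝ → ℝ) ∈
      levelSpan (fun t (z : (Fin n → ℝ) × ℝ) => @monXY n t z.1 z.2) t := fun t => by
    convert prod_pow_mul_pow_mem_levelSpan (n := n) (t := t) (a := 0) (k := 0) (by simp)
    simp
  refine ⟨fun t i => by unfold monXY; fun_prop, one, mul_mem_levelSpan_monXY, fun z => ?_⟩
  have const : ∀ c : ℝ, (fun _ : (Fin n → ℝ) × ℝ => c) ∈
      levelSpan (fun t (z : (Fin n → ℝ) × ℝ) => @monXY n t z.1 z.2) 1 := fun c => by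
    convert Submodule.smul_mem _ c (one 1)
    simp
  have coord : ∀ i, (fun w : (Fin n → ℝ) × ℝ => w.1 i - z.1 i) ∈
      levelSpan (fun t (z : (Fin n → ℝ) × ℝ) => @monXY n t z.1 z.2) 1 := by
    intro i
    refine sub_mem ?_ ?_
    · have := prod_pow_mul_pow_mem_levelSpan (n := n) (t := 1) (a := Pi.single i 1) (k := 0)
        (by simp)
      simpa [Pi.single_apply, pow_ite] using this
    · exact const _
  have coord' : (fun w : (Fin n → ℝ) × ℝ => w.2 - z.2) ∈
      levelSpan (fun t (z : (Fin n → ℝ) × ℝ) => @monXY n t z.1 z.2) 1 := by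
    refine sub_mem ?_ ?_
    · have := prod_pow_mul_pow_mem_levelSpan (n := n) (t := 1) (a := 0) (k := 1) (by simp)
      simpa using this
    · exact const _
  have sq_mem : ∀ {p}, p ∈ levelSpan (fun t (z : (Fin n → ℝ) × ℝ) => @monXY n t z.1 z.2) 1 →
      p * p ∈ levelSpan (fun t (z : (Fin n → ℝ) × ℝ) => @monXY n t z.1 z.2) 2 := fun hp => by
    have := mul_mem_levelSpan_monXY hp hp
    rwa [one_add_one_eq_two] at this
  refine ⟨∑ i, (fun w : (Fin n → ℝ) × ℝ => w.1 i - z.1 i) * (fun w => w.1 i - z.1 i) +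
      (fun w => w.2 - z.2) * (fun w => w.2 - z.2),
    add_mem (sum_mem fun i _ => sq_mem (coord i)) (sq_mem coord'), by simp,
    fun w hw => ?_⟩
  simp only [Pi.add_apply, Finset.sum_apply, Pi.mul_apply]
  by_cases h1 : w.1 = z.1
  · have h2 : w.2 ≠ z.2 := fun h2 => hw (Prod.ext h1 h2)
    exact add_pos_of_nonneg_of_pos (Finset.sum_nonneg fun j _ => mul_self_nonneg _)
      (mul_self_pos.mpr (sub_ne_zero.mpr h2))
  · obtain ⟨i, hi⟩ := Function.ne_iff.mp h1
    exact add_pos_of_pos_of_nonneg (Finset.sum_pos' (fun j _ => mul_self_nonneg _)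
      ⟨i, Finset.mem_univ i, mul_self_pos.mpr (sub_ne_zero.mpr hi)⟩) (mul_self_nonneg _)

/-- The moment matrix of the marginal is a principal submatrix of the joint moment matrix. -/
lemma posDef_momMatX_map_fst {n t : ℕ} {μ : Measure ((Fin n → ℝ) × ℝ)}
    (h : (momMatXY n t μ).PosDef) : (momMatX n t (μ.map Prod.fst)).PosDef := by
  let e : MIdx n t → XYIdx n t := fun α => ⟨(α.1, 0), by simpa using α.2⟩
  have he : Function.Injective e := fun α β hαβ =>
    Subtype.ext (congrArg (fun γ : XYIdx n t => γ.1.1) hαβ)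
  convert h.submatrix he using 1
  ext α β
  have hc : Continuous fun x : Fin n → ℝ => mon x α * mon x β := by unfold mon; fun_prop
  simp only [momMatX, submatrix_apply, momMatXY]
  rw [integral_map measurable_fst.aemeasurable hc.aestronglyMeasurable]
  simp [e, mon, monXY]

end Monomials

section Marginals

variable {α : Type*} [MeasurableSpace α] {φ : Measure α} [SFinite φ] {κ : Kernel α ℝ}
  [IsMarkovKernel κ] {f : α × ℝ → ℝ} {a b : ℝ}

/-- Conditional means of a bounded function obey the same bounds. -/
lemma ae_integral_kernel_mem_Icc (hf : Measurable f)
    (hab : ∀ᵐ z ∂(φ ⊗ₘ κ), a ≤ f z ∧ f z ≤ b) :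
    ∀ᵐ x ∂φ, Integrable (fun y => f (x, y)) (κ x) ∧ a ≤ ∫ y, f (x, y) ∂(κ x) ∧
      ∫ y, f (x, y) ∂(κ x) ≤ b := by
  filter_upwards [Measure.ae_ae_of_ae_compProd hab] with x hx
  have hi : Integrable (fun y => f (x, y)) (κ x) :=
    Integrable.of_mem_Icc a b (hf.comp measurable_prodMk_left).aemeasurable hx
  refine ⟨hi, ?_, ?_⟩
  · simpa using integral_mono_ae (integrable_const a) hi (hx.mono fun y hy => hy.1)
  · simpa using integral_mono_ae hi (integrable_const b) (hx.mono fun y hy => hy.2)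

lemma map_fst_withDensity_compProd (hf : Measurable f) (ha : 0 ≤ a)
    (hab : ∀ᵐ z ∂(φ ⊗ₘ κ), a ≤ f z ∧ f z ≤ b) :
    ((φ ⊗ₘ κ).withDensity fun z => ENNReal.ofReal (f z)).map Prod.fst =
      φ.withDensity fun x => ENNReal.ofReal (∫ y, f (x, y) ∂(κ x)) := by
  ext s hs
  rw [Measure.map_apply measurable_fst hs, withDensity_apply _ (measurable_fst hs),
    withDensity_apply _ hs, ← Set.prod_univ,
    Measure.setLIntegral_compProd hf.ennreal_ofReal hs MeasurableSet.univ]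
  refine lintegral_congr_ae (ae_restrict_of_ae ?_)
  filter_upwards [Measure.ae_ae_of_ae_compProd hab, ae_integral_kernel_mem_Icc hf hab] with x hx hi
  rw [Measure.restrict_univ, ofReal_integral_eq_lintegral_ofReal hi.1
    (hx.mono fun y hy => ha.trans hy.1)]

end Marginals

lemma natCast_mul_sdim_div_tendsto (n : ℕ) :
    Tendsto (fun t : ℕ => (t : ℝ) * (sdim n t / sdim (n + 1) t)) atTop (𝓝 (n + 1)) := by
  have h : Tendsto (fun t : ℕ => ((n : ℝ) + 1) / t) atTop (𝓝 0) :=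
    tendsto_const_div_atTop_nhds_zero_nat _
  have h' := ((h.add_const 1).inv₀ (by norm_num)).const_mul ((n : ℝ) + 1)
  rw [zero_add, inv_one, mul_one] at h'
  refine h'.congr' ?_
  filter_upwards [eventually_gt_atTop 0] with t ht
  have := (sdim_pos n t).ne'
  have : (t : ℝ) ≠ 0 := by positivity
  have : (n : ℝ) + 1 + t ≠ 0 := by positivity
  rw [sdim_succ]
  field_simp

/-- Let `Ω ⊆ X × ℝ ⊆ ℝⁿ × ℝ` be compact with nonempty interior, and let `μ₀` be a
measure on `Ω` with marginal `φ₀ = (μ₀).map Prod.fst` on `X` and conditional probability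
kernel `κ₀` (so `μ₀ = φ₀ ⊗ₘ κ₀`), such that: (a) `s_{n+1}(t)·Λ^{μ₀}_t → W₀` uniformly
on compact subsets of `int(Ω)`, with `W₀` continuous and positive; (b)
`s_n(t)·Λ^{φ₀}_t → W₀'` uniformly on compact subsets of `int(X)`, with `W₀'` continuous
and positive; (c) the Feller-type property holds for `κ₀`.  Let `μ = f·μ₀` with `f`
continuous and positive on `Ω`, with marginal `φ`, let `g(x) = ∫ f(x,y) κ₀(x)(dy)`, and
let `(ν_{x,t})` be any family of measures on `ℝ` with positive definite moment matrices
such that `Λ^μ_t(x,y) = Λ^φ_t(x)·Λ^{ν_{x,t}}_t(y)` for all `x, y, t`.  Then for every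
`(x,y) ∈ int(Ω)`:
`lim_{t→∞} t·Λ^{ν_{x,t}}_t(y) = (n+1)·(f(x,y)/g(x))·(W₀(x,y)/W₀'(x))`. -/
theorem stmt13 (n : ℕ) (X : Set (Fin n → ℝ)) (Ω : Set ((Fin n → ℝ) × ℝ))
    (hΩc : IsCompact Ω) (hΩi : (interior Ω).Nonempty)
    (hΩX : Ω ⊆ X ×ˢ (Set.univ : Set ℝ))
    (μ₀ : Measure ((Fin n → ℝ) × ℝ)) [IsFiniteMeasure μ₀] (hsupp₀ : μ₀ Ωᶜ = 0)
    (κ₀ : Kernel (Fin n → ℝ) ℝ) [IsMarkovKernel κ₀]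
    (hdis : μ₀ = (μ₀.map Prod.fst) ⊗ₘ κ₀)
    (hPD₀ : ∀ t : ℕ, (momMatXY n t μ₀).PosDef)
    (W₀ : (Fin n → ℝ) × ℝ → ℝ) (W₀' : (Fin n → ℝ) → ℝ)
    -- (a)
    (ha : ∀ K ⊆ interior Ω, IsCompact K →
      TendstoUniformlyOn (fun (t : ℕ) (z : (Fin n → ℝ) × ℝ) =>
        (sdim (n + 1) t : ℝ) * CFXY n t μ₀ z.1 z.2) W₀ atTop K)
    (hW₀c : ContinuousOn W₀ (interior Ω)) (hW₀p : ∀ z ∈ interior Ω, 0 < W₀ z)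
    -- (b)
    (hb : ∀ K ⊆ interior X, IsCompact K →
      TendstoUniformlyOn (fun (t : ℕ) (x : Fin n → ℝ) =>
        (sdim n t : ℝ) * CFX n t (μ₀.map Prod.fst) x) W₀' atTop K)
    (hW₀'c : ContinuousOn W₀' (interior X)) (hW₀'p : ∀ x ∈ interior X, 0 < W₀' x)
    -- (c) Feller-type property
    (hFeller : ∀ h : (Fin n → ℝ) × ℝ → ℝ, ContinuousOn h Ω →
      ContinuousOn (fun x => ∫ y, h (x, y) ∂(κ₀ x)) X)
    -- the measure μ with density f w.r.t. μ₀
    (f : (Fin n → ℝ) × ℝ → ℝ) (hf_meas : Measurable f)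
    (hfc : ContinuousOn f Ω) (hfp : ∀ z ∈ Ω, 0 < f z)
    (μ : Measure ((Fin n → ℝ) × ℝ))
    (hμ : μ = μ₀.withDensity (fun z => ENNReal.ofReal (f z)))
    (hPD : ∀ t : ℕ, (momMatXY n t μ).PosDef)
    (g : (Fin n → ℝ) → ℝ) (hg : ∀ x, g x = ∫ y, f (x, y) ∂(κ₀ x))
    -- the disintegration family of Christoffel functions
    (ν : (Fin n → ℝ) → ℕ → Measure ℝ)
    (hνPD : ∀ (x : Fin n → ℝ) (t : ℕ), (hankelM t (ν x t)).PosDef)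
    (hfact : ∀ (x : Fin n → ℝ) (t : ℕ) (y : ℝ),
      CFXY n t μ x y = CFX n t (μ.map Prod.fst) x * CFY t (ν x t) y) :
    ∀ z ∈ interior Ω,
      Tendsto (fun t : ℕ => (t : ℝ) * CFY t (ν z.1 t) z.2) atTop
        (nhds ((n + 1 : ℝ) * (f z / g z.1) * (W₀ z / W₀' z.1))) := by
  intro z hz
  have hzΩ := interior_subset hz
  have hxX : z.1 ∈ interior X := by
    have hsub : Prod.fst '' interior Ω ⊆ X := by
      rintro _ ⟨w, hw, rfl⟩
      exact (hΩX (interior_subset hw)).1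
    exact interior_maximal hsub (isOpenMap_fst _ isOpen_interior) ⟨z, hz, rfl⟩
  obtain ⟨za, hza, hmin⟩ := hΩc.exists_isMinOn ⟨z, hzΩ⟩ hfc
  obtain ⟨zb, -, hmax⟩ := hΩc.exists_isMaxOn ⟨z, hzΩ⟩ hfc
  have ha0 : 0 < f za := hfp za hza
  have hfab : ∀ᵐ w ∂μ₀, f za ≤ f w ∧ f w ≤ f zb :=
    Eventually.mono (mem_ae_iff.mpr hsupp₀ : ∀ᵐ w ∂μ₀, w ∈ Ω) fun w hw => ⟨hmin hw, hmax hw⟩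
  have hfab' : ∀ᵐ w ∂(μ₀.map Prod.fst ⊗ₘ κ₀), f za ≤ f w ∧ f w ≤ f zb := by rwa [← hdis]
  have hgab := ae_integral_kernel_mem_Icc hf_meas hfab'
  simp_rw [← hg] at hgab
  have hφ : μ.map Prod.fst = (μ₀.map Prod.fst).withDensity fun x => ENNReal.ofReal (g x) := by
    have := map_fst_withDensity_compProd hf_meas ha0.le hfab'
    rw [← hdis, ← hμ] at this
    simp_rw [this, hg]
  have hφ₀K : (μ₀.map Prod.fst) (Prod.fst '' Ω)ᶜ = 0 := by
    rw [Measure.map_apply measurable_fst (hΩc.image continuous_fst).measurableSet.compl]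
    exact measure_mono_null (fun w hw hwΩ => hw ⟨w, hwΩ, rfl⟩) hsupp₀
  have hgc : ContinuousAt g z.1 := by
    have := (hFeller f hfc).continuousAt (mem_interior_iff_mem_nhds.mp hxX)
    simpa only [← hg] using this
  have hlimXY := (ha {z} (by simpa using hz) isCompact_singleton).tendsto_at rfl
  have hlimX := (hb {z.1} (by simpa using hxX) isCompact_singleton).tendsto_at rfl
  have hvX := isMonomialSystem_mon n
  have hPDX₀ := fun t => posDef_momMatX_map_fst (hPD₀ t)
  have hPDX := fun t => posDef_momMatX_map_fst (hPD t)
  have hgpos : 0 < g z.1 := by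
    refine ha0.trans_le (not_lt.mp fun hlt => ?_)
    obtain ⟨U, hUg, hU, hzU⟩ := eventually_nhds_iff.mp (hgc.eventually_lt_const hlt)
    refine hvX.measure_ne_zero (hΩc.image continuous_fst) hφ₀K hPDX₀ (hW₀'p _ hxX) hlimX hU hzU ?_
    have hnull : ∀ᵐ x ∂μ₀.map Prod.fst, x ∉ U :=
      hgab.mono fun x hx hxU => (hUg x hxU).not_ge hx.2.1
    simpa [ae_iff] using hnull
  have limXY : Tendsto (fun t => (sdim (n + 1) t : ℝ) * CFXY n t μ z.1 z.2) atTop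
      (𝓝 (f z * W₀ z)) :=
    (isMonomialSystem_monXY n).tendsto_sdim_mul_christoffel_withDensity hΩc hsupp₀ hμ ha0
      (hfab.mono fun w hw => hw.1) (hfab.mono fun w hw => hw.2) hPD₀ hPD
      (hfc.continuousAt (mem_interior_iff_mem_nhds.mp hz)) (hfp z hzΩ) (hW₀p z hz) hlimXY
  have limX : Tendsto (fun t => (sdim n t : ℝ) * CFX n t (μ.map Prod.fst) z.1) atTop
      (𝓝 (g z.1 * W₀' z.1)) :=
    hvX.tendsto_sdim_mul_christoffel_withDensity (hΩc.image continuous_fst) hφ₀K hφ ha0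
      (hgab.mono fun w hw => hw.2.1) (hgab.mono fun w hw => hw.2.2) hPDX₀ hPDX
      hgc hgpos (hW₀'p _ hxX) hlimX
  have hlim := (natCast_mul_sdim_div_tendsto n).mul
    (limXY.div limX (mul_pos hgpos (hW₀'p _ hxX)).ne')
  rw [mul_assoc, div_mul_div_comm]
  refine hlim.congr fun t => ?_
  have hX : CFX n t (μ.map Prod.fst) z.1 ≠ 0 := (hvX.christoffel_pos (hPDX t) z.1).ne'
  have h1 := (sdim_pos n t).ne'
  have h2 := (sdim_pos (n + 1) t).ne'
  simp only [Pi.div_apply, hfact]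
  field_simp
end
end
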